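/- arXiv:2309.13615 — 2 statements merged into one kernel-verified Lean document; each statement's English description precedes it below -/
import Mathlib

section
/- For every composition α of n and every subset S ⊆ [n-1], the number of permutations π ∈ S_n with co(π⁻¹) = α and Des(π) = S equals the number of standard Young tableaux Q of ribbon shape Z_α with Des(Q) = S. In other words, the distribution of the descent set is the same over the inverse descent class D_α⁻¹ and over SYT(Z_α). -/
/-- The lengths of the maximal increasing runs of a list of natural numbers
(the descent composition of the word). -/
def dco : List ℕ → List ℕ
  | [] => []
  | a :: rest =>
    match dco rest, rest with
    | m :: t, b :: _ => if a < b then (m + 1) :: t else 1 :: m :: t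
    | _, _ => [1]

/-- The one-line word of a permutation of `Fin n` (0-indexed values). -/
def word {n : ℕ} (π : Equiv.Perm (Fin n)) : List ℕ :=
  (List.finRange n).map fun i => (π i : ℕ)

/-- The descent set of a permutation, as a set of positions `i ∈ {1, …, n-1}`
(1-indexed: `i` is a descent when `π_i > π_{i+1}`). -/
def DesPerm {n : ℕ} (π : Equiv.Perm (Fin n)) : Set ℕ :=
  {i | ∃ (h1 : 1 ≤ i) (h2 : i < n),
        (π ⟨i, h2⟩ : ℕ) < (π ⟨i - 1, by omega⟩ : ℕ)}
/-- Auxiliary construction of the cells of a ribbon: each part of the list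
contributes a row, rows are read from bottom to top (in English (row, column)
coordinates the row coordinate decreases as we go up), and each new row starts
in the column of the last cell of the previous row. -/
def ribbonAux : List ℕ → ℤ × ℤ → Finset (ℤ × ℤ)
  | [], _ => ∅
  | a :: rest, p =>
      ((Finset.range a).image fun j : ℕ => (p.1, p.2 + (j : ℤ))) ∪
        ribbonAux rest (p.1 - 1, p.2 + (a : ℤ) - 1)

/-- The cells of the ribbon (zigzag diagram) whose row lengths, read from
bottom to top, are the entries of `l`. -/
def ribbonOfList (l : List ℕ) : Finset (ℤ × ℤ) := ribbonAux l (0, 0)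
/-- `T` is a standard Young tableau of the (skew) shape with cell set `D` and
`n` cells: `T` is zero outside `D`, restricts to a bijection from `D` onto
`{1, …, n}`, and increases along rows (left to right) and columns (top to
bottom, in English notation where the row coordinate increases downwards). -/
def IsSYT (D : Finset (ℤ × ℤ)) (n : ℕ) (T : ℤ × ℤ → ℕ) : Prop :=
  (∀ c ∉ D, T c = 0) ∧
  Set.BijOn T (D : Set (ℤ × ℤ)) (Set.Icc 1 n) ∧
  (∀ c ∈ D, (c.1, c.2 + 1) ∈ D → T c < T (c.1, c.2 + 1)) ∧
  (∀ c ∈ D, (c.1 + 1, c.2) ∈ D → T c < T (c.1 + 1, c.2))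

/-- The descent set of a standard Young tableau `T` with cell set `D`:
all `i` such that `i + 1` appears in a lower row (larger row coordinate)
than `i`. -/
def desSetTab (D : Finset (ℤ × ℤ)) (T : ℤ × ℤ → ℕ) : Set ℕ :=
  {i | ∃ c ∈ D, ∃ c' ∈ D, T c = i ∧ T c' = i + 1 ∧ c.1 < c'.1}

/-- The number of rows of the ribbon with row lengths `l` that lie strictly below the `k`-th cell,
cells being numbered from `0` along the ribbon, starting at the bottom left. -/
def rowIndex : List ℕ → ℕ → ℕ
  | [], _ => 0
  | a :: l, k => if k < a then 0 else rowIndex l (k - a) + 1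

/-- The `k`-th cell of the ribbon with row lengths `l`. -/
def ribbonCell (l : List ℕ) (k : ℕ) : ℤ × ℤ := (-(rowIndex l k : ℤ), (k : ℤ) - rowIndex l k)

theorem rowIndex_zero {l : List ℕ} (hl : ∀ x ∈ l, 0 < x) : rowIndex l 0 = 0 := by
  cases l with
  | nil => rfl
  | cons a l => simp [rowIndex, hl a (by simp)]

theorem rowIndex_succ {l : List ℕ} (hl : ∀ x ∈ l, 0 < x) (k : ℕ) :
    rowIndex l (k + 1) = rowIndex l k ∨ rowIndex l (k + 1) = rowIndex l k + 1 := by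
  induction l generalizing k with
  | nil => simp [rowIndex]
  | cons a l ih =>
    have ha : 0 < a := hl a (by simp)
    have hl' : ∀ x ∈ l, 0 < x := fun x hx => hl x (by simp [hx])
    simp only [rowIndex]
    rcases lt_trichotomy (k + 1) a with h | h | h
    · simp [h, show k < a by omega]
    · simp [h, show k < a by omega, rowIndex_zero hl']
    · rw [if_neg (by omega), if_neg (by omega), show k + 1 - a = k - a + 1 by omega]
      have := ih hl' (k - a)
      omega

theorem rowIndex_monotone {l : List ℕ} (hl : ∀ x ∈ l, 0 < x) : Monotone (rowIndex l) :=
  monotone_nat_of_le_succ fun k => by have := rowIndex_succ hl k; omega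

theorem mem_ribbonAux {l : List ℕ} {p c : ℤ × ℤ} :
    c ∈ ribbonAux l p ↔ ∃ k < l.sum, p + ribbonCell l k = c := by
  induction l generalizing p with
  | nil => simp [ribbonAux]
  | cons a l ih =>
    simp only [ribbonAux, Finset.mem_union, Finset.mem_image, Finset.mem_range, ih, List.sum_cons]
    constructor
    · rintro (⟨k, hk, rfl⟩ | ⟨k, hk, rfl⟩)
      · refine ⟨k, by omega, ?_⟩
        ext <;> simp [ribbonCell, rowIndex, hk]
      · refine ⟨a + k, by omega, ?_⟩
        ext <;> simp [ribbonCell, rowIndex] <;> ring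
    · rintro ⟨k, hk, rfl⟩
      by_cases h : k < a
      · refine Or.inl ⟨k, h, ?_⟩
        ext <;> simp [ribbonCell, rowIndex, h]
      · refine Or.inr ⟨k - a, by omega, ?_⟩
        ext <;> simp [ribbonCell, rowIndex, h] <;> push_cast [show a ≤ k by omega] <;> ring

theorem mem_ribbonOfList {l : List ℕ} {c : ℤ × ℤ} :
    c ∈ ribbonOfList l ↔ ∃ k < l.sum, ribbonCell l k = c := by
  rw [ribbonOfList, mem_ribbonAux]
  simp [← Prod.zero_eq_mk]

theorem ribbonCell_injective (l : List ℕ) : Function.Injective (ribbonCell l) := by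
  intro j k h
  simp only [ribbonCell, Prod.mk.injEq] at h
  omega

theorem dco_cons_cons (a b : ℕ) (w : List ℕ) : ∃ m t, dco (b :: w) = (m + 1) :: t ∧
    dco (a :: b :: w) = if a < b then (m + 2) :: t else 1 :: (m + 1) :: t := by
  induction w generalizing a b with
  | nil => exact ⟨0, [], by simp [dco], by simp [dco]⟩
  | cons c w ih =>
    obtain ⟨m, t, h, h'⟩ := ih b c
    by_cases hbc : b < c
    · rw [if_pos hbc] at h'
      exact ⟨m + 1, t, h', by rw [dco.eq_def]; simp only [h']⟩
    · rw [if_neg hbc] at h'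
      exact ⟨0, (m + 1) :: t, h', by rw [dco.eq_def]; simp only [h']⟩

/-- The descent composition of a word is `l` iff its ascents are the steps which stay in a row of
the ribbon with row lengths `l`. -/
theorem dco_eq_iff (w l : List ℕ) (hl : ∀ x ∈ l, 0 < x) (hsum : l.sum = w.length) :
    dco w = l ↔ ∀ k, k + 1 < w.length →
      (w.getD k 0 < w.getD (k + 1) 0 ↔ rowIndex l (k + 1) = rowIndex l k) := by
  induction w generalizing l with
  | nil =>
    cases l with
    | nil => simp [dco]
    | cons x l =>
      have := hl x (by simp)
      simp at hsum
      omega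
  | cons a w ih =>
    cases l with
    | nil => simp at hsum
    | cons x l =>
      have hx := hl x (by simp)
      have hl' : ∀ y ∈ l, 0 < y := fun y hy => hl y (by simp [hy])
      cases w with
      | nil =>
        simp only [List.sum_cons, List.length_cons, List.length_nil] at hsum
        have hl0 : l = [] := by
          cases l with
          | nil => rfl
          | cons y l =>
            have := hl' y (by simp)
            simp at hsum
            omega
        subst hl0
        simp at hsum
        simp [dco, hsum]
      | cons b w =>
        obtain ⟨m, t, hb, hab⟩ := dco_cons_cons a b w
        rw [hab]
        simp only [List.sum_cons, List.length_cons] at hsum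
        obtain ⟨x, rfl⟩ : ∃ y, x = y + 1 := ⟨x - 1, by omega⟩
        rcases Nat.eq_zero_or_pos x with rfl | hx0
        · have hrow : ∀ k, rowIndex ((0 + 1) :: l) (k + 1) = rowIndex l k + 1 := by
            intro k; simp [rowIndex]
          have hrow0 : rowIndex ((0 + 1) :: l) 0 = 0 := by simp [rowIndex]
          have ih' := ih l hl' (by simp; omega)
          rw [hb] at ih'
          rw [← Nat.and_forall_add_one]
          simp only [hrow, hrow0, List.getD_cons_succ, List.getD_cons_zero, List.length_cons,
            add_lt_add_iff_right, add_left_inj] at ih' ⊢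
          rw [← ih']
          by_cases h : a < b <;> simp [h]
        · have hrow : ∀ k, rowIndex ((x + 1) :: l) (k + 1) = rowIndex (x :: l) k := by
            intro k; simp [rowIndex]
          have hrow0 : rowIndex ((x + 1) :: l) 0 = 0 := by simp [rowIndex]
          have hrow1 : rowIndex (x :: l) 0 = 0 := by simp [rowIndex, hx0]
          have ih' := ih (x :: l) (by simpa [hx0] using hl') (by simp; omega)
          rw [hb] at ih'
          rw [← Nat.and_forall_add_one]
          simp only [hrow, hrow0, hrow1, List.getD_cons_succ, List.getD_cons_zero,
            List.length_cons, add_lt_add_iff_right, List.cons.injEq] at ih' ⊢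
          rw [← ih']
          by_cases h : a < b <;> simp [h]
          omega

theorem dco_word_eq_iff {n : ℕ} (σ : Equiv.Perm (Fin n)) {l : List ℕ} (hl : ∀ x ∈ l, 0 < x)
    (hsum : l.sum = n) :
    dco (word σ) = l ↔ ∀ j k : Fin n, (k : ℕ) = j + 1 →
      (σ j < σ k ↔ rowIndex l k = rowIndex l j) := by
  have hlen : (word σ).length = n := by simp [word]
  have hget (k : Fin n) : (word σ).getD k 0 = σ k := by
    rw [List.getD_eq_getElem _ _ (by simp [hlen])]
    simp [word]
  rw [dco_eq_iff _ _ hl (by rw [hlen, hsum]), hlen]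
  constructor
  · intro h j k hk
    have := h j (by omega)
    rwa [← hk, hget, hget, Fin.val_fin_lt] at this
  · intro h k hk
    have := h ⟨k, by omega⟩ ⟨k + 1, hk⟩ rfl
    rwa [← Fin.val_fin_lt, ← hget, ← hget] at this

/-- The filling of the ribbon with row lengths `l` by the one-line word of `σ`
(with values in `{1, …, n}`), read from bottom left to top right. -/
noncomputable def ribbonFilling {n : ℕ} (l : List ℕ) (σ : Equiv.Perm (Fin n)) : ℤ × ℤ → ℕ :=
  Function.extend (fun k : Fin n => ribbonCell l k) (fun k => (σ k : ℕ) + 1) 0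

section Filling

variable {n : ℕ} {l : List ℕ}

theorem ribbonFilling_ribbonCell (l : List ℕ) (σ : Equiv.Perm (Fin n)) (k : Fin n) :
    ribbonFilling l σ (ribbonCell l k) = σ k + 1 :=
  ((ribbonCell_injective l).comp Fin.val_injective).extend_apply _ _ k

theorem mem_ribbonOfList_iff_exists_fin (hsum : l.sum = n) {c : ℤ × ℤ} :
    c ∈ ribbonOfList l ↔ ∃ k : Fin n, ribbonCell l k = c := by
  rw [mem_ribbonOfList, hsum]
  exact ⟨fun ⟨k, hk, h⟩ => ⟨⟨k, hk⟩, h⟩, fun ⟨k, h⟩ => ⟨k, k.2, h⟩⟩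

theorem ribbonFilling_eq_zero (hsum : l.sum = n) (σ : Equiv.Perm (Fin n)) {c : ℤ × ℤ}
    (hc : c ∉ ribbonOfList l) : ribbonFilling l σ c = 0 :=
  Function.extend_apply' _ _ _ (by rwa [mem_ribbonOfList_iff_exists_fin hsum] at hc)

theorem ribbonFilling_bijOn (hsum : l.sum = n) (σ : Equiv.Perm (Fin n)) :
    Set.BijOn (ribbonFilling l σ) (ribbonOfList l : Set (ℤ × ℤ)) (Set.Icc 1 n) := by
  refine ⟨?_, ?_, ?_⟩
  · intro c hc
    obtain ⟨k, rfl⟩ := (mem_ribbonOfList_iff_exists_fin hsum).1 hc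
    rw [ribbonFilling_ribbonCell, Set.mem_Icc]
    omega
  · intro c hc c' hc' h
    obtain ⟨k, rfl⟩ := (mem_ribbonOfList_iff_exists_fin hsum).1 hc
    obtain ⟨k', rfl⟩ := (mem_ribbonOfList_iff_exists_fin hsum).1 hc'
    rw [ribbonFilling_ribbonCell, ribbonFilling_ribbonCell, add_left_inj, Fin.val_inj,
      σ.injective.eq_iff] at h
    rw [h]
  · intro i hi
    rw [Set.mem_Icc] at hi
    refine ⟨ribbonCell l (σ.symm ⟨i - 1, by omega⟩),
      (mem_ribbonOfList_iff_exists_fin hsum).2 ⟨_, rfl⟩, ?_⟩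
    rw [ribbonFilling_ribbonCell, Equiv.apply_symm_apply]
    exact Nat.sub_add_cancel hi.1

theorem ribbonFilling_injective (l : List ℕ) :
    Function.Injective (ribbonFilling l : Equiv.Perm (Fin n) → ℤ × ℤ → ℕ) := by
  intro σ τ h
  ext k
  have := congrFun h (ribbonCell l k)
  simpa [ribbonFilling_ribbonCell] using this

theorem exists_ribbonFilling_eq (hsum : l.sum = n) {T : ℤ × ℤ → ℕ}
    (h0 : ∀ c ∉ ribbonOfList l, T c = 0)
    (hT : Set.BijOn T (ribbonOfList l : Set (ℤ × ℤ)) (Set.Icc 1 n)) :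
    ∃ σ : Equiv.Perm (Fin n), ribbonFilling l σ = T := by
  have hmem (k : Fin n) : ribbonCell l k ∈ ribbonOfList l :=
    (mem_ribbonOfList_iff_exists_fin hsum).2 ⟨k, rfl⟩
  have hIcc (k : Fin n) : 1 ≤ T (ribbonCell l k) ∧ T (ribbonCell l k) ≤ n := hT.mapsTo (hmem k)
  let f : Fin n → Fin n := fun k => ⟨T (ribbonCell l k) - 1, by have := hIcc k; omega⟩
  have hf : Function.Injective f := by
    intro j k h
    have hj := hIcc j
    have hk := hIcc k
    have h' : T (ribbonCell l j) = T (ribbonCell l k) := by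
      simp only [f, Fin.mk.injEq] at h
      omega
    exact Fin.val_injective (ribbonCell_injective l (hT.injOn (hmem j) (hmem k) h'))
  refine ⟨Equiv.ofBijective f hf.bijective_of_finite, funext fun c => ?_⟩
  by_cases hc : c ∈ ribbonOfList l
  · obtain ⟨k, rfl⟩ := (mem_ribbonOfList_iff_exists_fin hsum).1 hc
    rw [ribbonFilling_ribbonCell]
    exact Nat.sub_add_cancel (hIcc k).1
  · rw [ribbonFilling_eq_zero hsum _ hc, h0 c hc]

theorem isSYT_ribbonFilling_iff (hl : ∀ x ∈ l, 0 < x) (hsum : l.sum = n)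
    (σ : Equiv.Perm (Fin n)) :
    IsSYT (ribbonOfList l) n (ribbonFilling l σ) ↔ dco (word σ) = l := by
  rw [dco_word_eq_iff σ hl hsum]
  constructor
  · rintro ⟨-, -, hrow, hcol⟩ j k hk
    have hj : ribbonCell l j ∈ ribbonOfList l :=
      (mem_ribbonOfList_iff_exists_fin hsum).2 ⟨j, rfl⟩
    have hk' : ribbonCell l k ∈ ribbonOfList l :=
      (mem_ribbonOfList_iff_exists_fin hsum).2 ⟨k, rfl⟩
    have hstep := rowIndex_succ hl j
    rw [← hk] at hstep
    rcases hstep with h | h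
    · have hc : ((ribbonCell l j).1, (ribbonCell l j).2 + 1) = ribbonCell l k := by
        simp only [ribbonCell, Prod.mk.injEq]
        omega
      have := hrow _ hj (by rwa [hc])
      rw [hc, ribbonFilling_ribbonCell, ribbonFilling_ribbonCell] at this
      rw [← Fin.val_fin_lt]
      omega
    · have hc : ((ribbonCell l k).1 + 1, (ribbonCell l k).2) = ribbonCell l j := by
        simp only [ribbonCell, Prod.mk.injEq]
        omega
      have := hcol _ hk' (by rwa [hc])
      rw [hc, ribbonFilling_ribbonCell, ribbonFilling_ribbonCell] at this
      rw [← Fin.val_fin_lt]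
      omega
  · intro h
    refine ⟨fun c => ribbonFilling_eq_zero hsum σ, ribbonFilling_bijOn hsum σ, ?_, ?_⟩
    · intro c hc hc'
      obtain ⟨j, rfl⟩ := (mem_ribbonOfList_iff_exists_fin hsum).1 hc
      obtain ⟨k, hk⟩ := (mem_ribbonOfList_iff_exists_fin hsum).1 hc'
      rw [← hk, ribbonFilling_ribbonCell, ribbonFilling_ribbonCell]
      simp only [ribbonCell, Prod.mk.injEq] at hk
      have := (h j k (by omega)).2 (by omega)
      rw [← Fin.val_fin_lt] at this
      omega
    · intro c hc hc'
      obtain ⟨k, rfl⟩ := (mem_ribbonOfList_iff_exists_fin hsum).1 hc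
      obtain ⟨j, hj⟩ := (mem_ribbonOfList_iff_exists_fin hsum).1 hc'
      rw [← hj, ribbonFilling_ribbonCell, ribbonFilling_ribbonCell]
      simp only [ribbonCell, Prod.mk.injEq] at hj
      have hlt := mt (h j k (by omega)).1 (by omega)
      have hne : σ j ≠ σ k := by
        intro e
        have := congrArg Fin.val (σ.injective e)
        omega
      rw [← Fin.val_fin_lt] at hlt
      rw [← Fin.val_ne_iff] at hne
      omega

theorem lt_of_rowIndex_eq (hl : ∀ x ∈ l, 0 < x) (hsum : l.sum = n) {σ : Equiv.Perm (Fin n)}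
    (h : dco (word σ) = l) {j k : Fin n} (hjk : j < k) (hrow : rowIndex l j = rowIndex l k) :
    σ j < σ k := by
  rw [dco_word_eq_iff σ hl hsum] at h
  obtain ⟨k, hk⟩ := k
  replace hjk : (j : ℕ) + 1 ≤ k := hjk
  induction k, hjk using Nat.le_induction with
  | base => exact (h j ⟨j + 1, hk⟩ rfl).2 hrow.symm
  | succ k hjk ih =>
    have h1 : rowIndex l j ≤ rowIndex l k := rowIndex_monotone hl (by omega)
    have h2 : rowIndex l k ≤ rowIndex l (k + 1) := rowIndex_monotone hl (by omega)
    replace hrow : rowIndex l j = rowIndex l (k + 1) := hrow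
    have hlt : σ ⟨k, by omega⟩ < σ ⟨k + 1, hk⟩ := (h ⟨k, by omega⟩ ⟨k + 1, hk⟩ rfl).2 (by
      change rowIndex l (k + 1) = rowIndex l k
      omega)
    exact (ih (by omega) (by change rowIndex l j = rowIndex l k; omega)).trans hlt

theorem desSetTab_ribbonFilling_inv (hl : ∀ x ∈ l, 0 < x) (hsum : l.sum = n)
    {π : Equiv.Perm (Fin n)} (h : dco (word π⁻¹) = l) :
    desSetTab (ribbonOfList l) (ribbonFilling l π⁻¹) = DesPerm π := by
  ext i
  constructor
  · rintro ⟨c, hc, c', hc', rfl, hi, hlt⟩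
    obtain ⟨j, rfl⟩ := (mem_ribbonOfList_iff_exists_fin hsum).1 hc
    obtain ⟨k, rfl⟩ := (mem_ribbonOfList_iff_exists_fin hsum).1 hc'
    simp only [ribbonFilling_ribbonCell, add_left_inj] at hi ⊢
    have hkj : (k : ℕ) < j := by
      by_contra! hjk
      have := rowIndex_monotone hl hjk
      simp only [ribbonCell] at hlt
      omega
    refine ⟨by omega, by omega, ?_⟩
    have h1 : (⟨(π⁻¹ j : Fin n) + 1, by omega⟩ : Fin n) = π⁻¹ k := Fin.ext hi.symm
    have h2 : (⟨(π⁻¹ j : Fin n) + 1 - 1, by omega⟩ : Fin n) = π⁻¹ j := Fin.ext (by simp)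
    rw [h1, h2]
    simpa using hkj
  · rintro ⟨hi, hin, hlt⟩
    refine ⟨ribbonCell l (π ⟨i - 1, by omega⟩),
      (mem_ribbonOfList_iff_exists_fin hsum).2 ⟨_, rfl⟩, ribbonCell l (π ⟨i, hin⟩),
      (mem_ribbonOfList_iff_exists_fin hsum).2 ⟨_, rfl⟩, ?_, ?_, ?_⟩
    · rw [ribbonFilling_ribbonCell, Equiv.Perm.coe_inv, Equiv.symm_apply_apply]
      exact Nat.sub_add_cancel hi
    · rw [ribbonFilling_ribbonCell, Equiv.Perm.coe_inv, Equiv.symm_apply_apply]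
    · have hle := rowIndex_monotone hl hlt.le
      have hne : rowIndex l (π ⟨i, hin⟩) ≠ rowIndex l (π ⟨i - 1, by omega⟩) := by
        intro e
        have := lt_of_rowIndex_eq hl hsum h hlt e
        rw [Equiv.Perm.coe_inv, Equiv.symm_apply_apply, Equiv.symm_apply_apply, Fin.mk_lt_mk] at this
        omega
      simp only [ribbonCell]
      omega

end Filling

/-- For every composition `α` of a positive integer `n` and
every subset `S ⊆ [n-1]`, the number of permutations `π ∈ S_n` with
`co(π⁻¹) = α` and `Des(π) = S` equals the number of standard Young tableaux `Q`
of ribbon shape `Z_α` with `Des(Q) = S`: the distribution of the descent set is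
the same over the inverse descent class `D_α⁻¹` and over `SYT(Z_α)`. -/
theorem statement1 (n : ℕ) (hn : 0 < n) (α : Composition n) (S : Set ℕ)
    (hS : S ⊆ Set.Icc 1 (n - 1)) :
    {π : Equiv.Perm (Fin n) | dco (word π⁻¹) = α.blocks ∧ DesPerm π = S}.ncard =
      {T : ℤ × ℤ → ℕ | IsSYT (ribbonOfList α.blocks) n T ∧
          desSetTab (ribbonOfList α.blocks) T = S}.ncard := by
  have hl : ∀ x ∈ α.blocks, 0 < x := fun x hx => α.blocks_pos hx
  have hsum := α.blocks_sum
  refine Set.ncard_congr (fun π _ => ribbonFilling α.blocks π⁻¹) ?_ ?_ ?_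
  · rintro π ⟨hπ, rfl⟩
    exact ⟨(isSYT_ribbonFilling_iff hl hsum _).2 hπ, desSetTab_ribbonFilling_inv hl hsum hπ⟩
  · intro π τ _ _ h
    exact inv_injective (ribbonFilling_injective _ h)
  · rintro T ⟨hT, rfl⟩
    obtain ⟨σ, rfl⟩ := exists_ribbonFilling_eq hsum hT.1 hT.2.1
    have hσ : dco (word σ⁻¹⁻¹) = α.blocks := by
      rw [inv_inv]
      exact (isSYT_ribbonFilling_iff hl hsum σ).1 hT
    refine ⟨σ⁻¹, ⟨hσ, ?_⟩, by rw [inv_inv]⟩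
    rw [← desSetTab_ribbonFilling_inv hl hsum hσ, inv_inv]
end

section
/- For every composition α of n, the ribbon Schur function satisfies r_α(x) = Σ_{π ∈ D_α⁻¹} F_{co(π)}(x) = Σ_{λ ⊢ n} c_λ(α) s_λ(x), where c_λ(α) is the number of standard Young tableaux Q of shape λ with co(Q) = α. In particular, the quasisymmetric generating function of the inverse descent class D_α⁻¹ is Schur-positive. -/
/-- Gessel's fundamental quasisymmetric function associated with the
composition `l` of `n` (in the variables `x_0, x_1, …`): the sum of
`x_{i_1} ⋯ x_{i_n}` over all weakly increasing sequences
`i_1 ≤ … ≤ i_n` that increase strictly at each position in the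
partial-sum set of `l`. -/
noncomputable def Fq (n : ℕ) (l : List ℕ) : MvPowerSeries ℕ ℤ := fun d =>
  (({i : Fin n → ℕ |
      Monotone i ∧
      (∀ k, k + 1 < l.length →
        ∀ (h1 : 1 ≤ (l.take (k + 1)).sum) (h2 : (l.take (k + 1)).sum < n),
          i ⟨(l.take (k + 1)).sum - 1, by omega⟩ < i ⟨(l.take (k + 1)).sum, h2⟩) ∧
      (∑ t : Fin n, Finsupp.single (i t) 1) = d}).ncard : ℤ)
/-- The (skew) Schur function of the shape with cell set `D`, as the generating
function of semistandard Young tableaux of shape `D`: fillings of `D` that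
weakly increase along rows and strictly increase down columns. -/
noncomputable def skewSchur (D : Finset (ℤ × ℤ)) : MvPowerSeries ℕ ℤ := fun d =>
  (({T : ℤ × ℤ → ℕ |
      (∀ c ∉ D, T c = 0) ∧
      (∀ c ∈ D, (c.1, c.2 + 1) ∈ D → T c ≤ T (c.1, c.2 + 1)) ∧
      (∀ c ∈ D, (c.1 + 1, c.2) ∈ D → T c < T (c.1 + 1, c.2)) ∧
      (∑ c ∈ D, Finsupp.single (T c) 1) = d}).ncard : ℤ)
open Classical in
/-- The descent set of a standard Young tableau `T` with cell set `D` and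
entries `1, …, n`, together with `n` (that is, `Des(T)⁺ = Des(T) ∪ {n}`),
as a finset. -/
noncomputable def desFinsetTab (D : Finset (ℤ × ℤ)) (n : ℕ) (T : ℤ × ℤ → ℕ) :
    Finset ℕ :=
  (Finset.Icc 1 n).filter fun i =>
    i = n ∨ ∃ c ∈ D, ∃ c' ∈ D, T c = i ∧ T c' = i + 1 ∧ c.1 < c'.1

/-- The descent composition of a standard Young tableau `T` with cell set `D`
and entries `1, …, n`: the list of successive differences of the elements of
`Des(T) ∪ {n}`. -/
noncomputable def coSYT (D : Finset (ℤ × ℤ)) (n : ℕ) (T : ℤ × ℤ → ℕ) : List ℕ :=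
  let L := (desFinsetTab D n T).sort (· ≤ ·)
  (List.range L.length).map fun k => L.getD k 0 - (if k = 0 then 0 else L.getD (k - 1) 0)

/-- The cells of a Young diagram, viewed in `ℤ × ℤ`. -/
def ydCells (μ : YoungDiagram) : Finset (ℤ × ℤ) :=
  μ.cells.image fun c => ((c.1 : ℤ), (c.2 : ℤ))

namespace RibbonSchur

open Finset

/-! ### Fillings of Young diagrams -/

/-- `f` is a semistandard filling of `μ`, extended by zero. -/
def IsSemistd (μ : YoungDiagram) (f : ℕ → ℕ → ℕ) : Prop :=
  (∀ i j, (i, j) ∉ μ → f i j = 0) ∧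
  (∀ i j, (i, j + 1) ∈ μ → f i j ≤ f i (j + 1)) ∧
  (∀ i j, (i + 1, j) ∈ μ → f i j < f (i + 1) j)

/-- Extension by zero of a function on the quadrant to the plane. -/
def toPlane (f : ℕ → ℕ → ℕ) (c : ℤ × ℤ) : ℕ :=
  if 0 ≤ c.1 ∧ 0 ≤ c.2 then f c.1.toNat c.2.toNat else 0

@[simp] lemma toPlane_natCast (f : ℕ → ℕ → ℕ) (i j : ℕ) : toPlane f ((i : ℤ), (j : ℤ)) = f i j := by
  simp [toPlane]

lemma toPlane_injective : Function.Injective toPlane := by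
  intro f g h
  funext i j
  have := congrFun h ((i : ℤ), (j : ℤ))
  simpa using this

lemma mem_ydCells_iff {μ : YoungDiagram} {c : ℤ × ℤ} :
    c ∈ ydCells μ ↔ ∃ i j : ℕ, c = ((i : ℤ), (j : ℤ)) ∧ (i, j) ∈ μ := by
  simp only [ydCells, Finset.mem_image, Prod.exists, YoungDiagram.mem_cells]
  constructor
  · rintro ⟨i, j, h, rfl⟩; exact ⟨i, j, rfl, h⟩
  · rintro ⟨i, j, rfl, h⟩; exact ⟨i, j, h, rfl⟩

@[simp] lemma natCast_mem_ydCells {μ : YoungDiagram} {i j : ℕ} :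
    ((i : ℤ), (j : ℤ)) ∈ ydCells μ ↔ (i, j) ∈ μ := by
  rw [mem_ydCells_iff]
  constructor
  · rintro ⟨a, b, h, h'⟩
    rw [Prod.mk.injEq, Nat.cast_inj, Nat.cast_inj] at h
    obtain ⟨rfl, rfl⟩ := h
    exact h'
  · intro h; exact ⟨i, j, rfl, h⟩

lemma eq_toPlane {μ : YoungDiagram} {T : ℤ × ℤ → ℕ} (h : ∀ c ∉ ydCells μ, T c = 0) :
    toPlane (fun i j : ℕ => T ((i : ℤ), (j : ℤ))) = T := by
  funext ⟨a, b⟩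
  simp only [toPlane]
  split_ifs with hc
  · simp [Int.toNat_of_nonneg hc.1, Int.toNat_of_nonneg hc.2]
  · refine (h _ fun hm => hc ?_).symm
    obtain ⟨i, j, he, -⟩ := mem_ydCells_iff.1 hm
    simp only [Prod.mk.injEq] at he
    omega

lemma toPlane_zero {μ : YoungDiagram} {f : ℕ → ℕ → ℕ} (h : ∀ i j, (i, j) ∉ μ → f i j = 0) :
    ∀ c ∉ ydCells μ, toPlane f c = 0 := by
  rintro ⟨a, b⟩ hc
  simp only [toPlane]
  split_ifs with h'
  · refine h _ _ fun hm => hc ?_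
    rw [← natCast_mem_ydCells, Int.toNat_of_nonneg h'.1, Int.toNat_of_nonneg h'.2] at hm
    exact hm
  · rfl

lemma forall_mem_ydCells {μ : YoungDiagram} {P : ℤ × ℤ → Prop} :
    (∀ c ∈ ydCells μ, P c) ↔ ∀ i j : ℕ, (i, j) ∈ μ → P ((i : ℤ), (j : ℤ)) := by
  constructor
  · intro h i j hm; exact h _ (natCast_mem_ydCells.2 hm)
  · intro h c hc
    obtain ⟨i, j, rfl, hm⟩ := mem_ydCells_iff.1 hc
    exact h i j hm

lemma sum_ydCells {M : Type*} [AddCommMonoid M] (μ : YoungDiagram) (g : ℤ × ℤ → M) :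
    ∑ c ∈ ydCells μ, g c = ∑ c ∈ μ.cells, g ((c.1 : ℤ), (c.2 : ℤ)) := by
  rw [ydCells, Finset.sum_image]
  rintro ⟨a, b⟩ - ⟨a', b'⟩ - h
  simpa using h

lemma natCast_succ_right_mem {μ : YoungDiagram} {i j : ℕ} :
    ((i : ℤ), (j : ℤ) + 1) ∈ ydCells μ ↔ (i, j + 1) ∈ μ := by
  rw [← natCast_mem_ydCells]; push_cast; rfl

lemma natCast_succ_left_mem {μ : YoungDiagram} {i j : ℕ} :
    ((i : ℤ) + 1, (j : ℤ)) ∈ ydCells μ ↔ (i + 1, j) ∈ μ := by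
  rw [← natCast_mem_ydCells]; push_cast; rfl

lemma mem_of_right {μ : YoungDiagram} {i j : ℕ} (h : (i, j + 1) ∈ μ) : (i, j) ∈ μ :=
  μ.up_left_mem le_rfl (Nat.le_succ j) h

lemma mem_of_below {μ : YoungDiagram} {i j : ℕ} (h : (i + 1, j) ∈ μ) : (i, j) ∈ μ :=
  μ.up_left_mem (Nat.le_succ i) le_rfl h

lemma isSemistd_iff {μ : YoungDiagram} {f : ℕ → ℕ → ℕ} :
    IsSemistd μ f ↔ (∀ c ∉ ydCells μ, toPlane f c = 0) ∧
      (∀ c ∈ ydCells μ, (c.1, c.2 + 1) ∈ ydCells μ → toPlane f c ≤ toPlane f (c.1, c.2 + 1)) ∧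
      (∀ c ∈ ydCells μ, (c.1 + 1, c.2) ∈ ydCells μ → toPlane f c < toPlane f (c.1 + 1, c.2)) := by
  rw [forall_mem_ydCells, forall_mem_ydCells]
  simp only [natCast_succ_right_mem, natCast_succ_left_mem]
  have e1 : ∀ i j : ℕ, toPlane f ((i : ℤ), (j : ℤ) + 1) = f i (j + 1) := fun i j => by
    exact_mod_cast toPlane_natCast f i (j + 1)
  have e2 : ∀ i j : ℕ, toPlane f ((i : ℤ) + 1, (j : ℤ)) = f (i + 1) j := fun i j => by
    exact_mod_cast toPlane_natCast f (i + 1) j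
  simp only [toPlane_natCast, e1, e2]
  constructor
  · rintro ⟨h0, h1, h2⟩
    exact ⟨toPlane_zero h0, fun i j _ h => h1 i j h, fun i j _ h => h2 i j h⟩
  · rintro ⟨h0, h1, h2⟩
    refine ⟨fun i j h => ?_, fun i j h => h1 i j (mem_of_right h) h,
      fun i j h => h2 i j (mem_of_below h) h⟩
    rw [← toPlane_natCast f]
    exact h0 _ (by simpa using h)

lemma skewSchur_ydCells (μ : YoungDiagram) (d : ℕ →₀ ℕ) :
    skewSchur (ydCells μ) d = ({f : ℕ → ℕ → ℕ | IsSemistd μ f ∧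
      ∑ c ∈ μ.cells, Finsupp.single (f c.1 c.2) 1 = d}.ncard : ℤ) := by
  unfold skewSchur
  rw [← Set.ncard_image_of_injective _ toPlane_injective]
  congr 2
  ext T
  constructor
  · rintro ⟨h0, h1, h2, h3⟩
    have e := eq_toPlane h0
    refine ⟨_, ⟨?_, ?_⟩, e⟩
    · rw [isSemistd_iff, e]
      exact ⟨h0, h1, h2⟩
    · rw [sum_ydCells] at h3
      exact h3
  · rintro ⟨f, ⟨h, h3⟩, rfl⟩
    obtain ⟨h0, h1, h2⟩ := isSemistd_iff.1 h
    refine ⟨h0, h1, h2, ?_⟩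
    rw [sum_ydCells]
    simpa using h3

/-- `i + 1` appears in a lower row than `i` in the filling `f` of `μ`. -/
def IsDesc (μ : YoungDiagram) (f : ℕ → ℕ → ℕ) (i : ℕ) : Prop :=
  ∃ a b a' b', (a, b) ∈ μ ∧ (a', b') ∈ μ ∧ f a b = i ∧ f a' b' = i + 1 ∧ a < a'

/-- `f` is a standard filling of `μ` with entries `1, …, n`, extended by zero. -/
def IsStd (μ : YoungDiagram) (n : ℕ) (f : ℕ → ℕ → ℕ) : Prop :=
  IsSemistd μ f ∧ Set.BijOn (fun c : ℕ × ℕ => f c.1 c.2) μ.cells (Set.Icc 1 n)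

lemma coe_ydCells (μ : YoungDiagram) :
    (ydCells μ : Set (ℤ × ℤ)) = (fun c : ℕ × ℕ => ((c.1 : ℤ), (c.2 : ℤ))) '' μ.cells := by
  simp [ydCells]

lemma isSYT_toPlane {μ : YoungDiagram} {n : ℕ} {f : ℕ → ℕ → ℕ} :
    IsSYT (ydCells μ) n (toPlane f) ↔ IsStd μ n f := by
  have inj : Set.InjOn (fun c : ℕ × ℕ => ((c.1 : ℤ), (c.2 : ℤ))) (μ.cells : Set (ℕ × ℕ)) := by
    rintro ⟨a, b⟩ - ⟨a', b'⟩ - h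
    simpa using h
  have hb : Set.BijOn (toPlane f) (ydCells μ : Set (ℤ × ℤ)) (Set.Icc 1 n) ↔
      Set.BijOn (fun c : ℕ × ℕ => f c.1 c.2) μ.cells (Set.Icc 1 n) := by
    rw [coe_ydCells, ← Set.bijOn_comp_iff inj]
    have : (toPlane f ∘ fun c : ℕ × ℕ => ((c.1 : ℤ), (c.2 : ℤ))) = fun c => f c.1 c.2 := by
      funext c; simp
    rw [this]
  rw [IsSYT, IsStd, isSemistd_iff, hb]
  constructor
  · rintro ⟨h0, hB, h1, h2⟩
    exact ⟨⟨h0, fun c hc hc' => (h1 c hc hc').le, h2⟩, hB⟩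
  · rintro ⟨⟨h0, h1, h2⟩, hB⟩
    refine ⟨h0, hB, fun c hc hc' => lt_of_le_of_ne (h1 c hc hc') fun he => ?_, h2⟩
    have := (hb.2 hB).injOn hc hc' he
    simp [Prod.ext_iff] at this

lemma isDesc_iff_toPlane {μ : YoungDiagram} {f : ℕ → ℕ → ℕ} {i : ℕ} :
    (∃ c ∈ ydCells μ, ∃ c' ∈ ydCells μ, toPlane f c = i ∧ toPlane f c' = i + 1 ∧ c.1 < c'.1) ↔
      IsDesc μ f i := by
  constructor
  · rintro ⟨c, hc, c', hc', h1, h2, h3⟩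
    obtain ⟨a, b, rfl, hm⟩ := mem_ydCells_iff.1 hc
    obtain ⟨a', b', rfl, hm'⟩ := mem_ydCells_iff.1 hc'
    exact ⟨a, b, a', b', hm, hm', by simpa using h1, by simpa using h2, by simpa using h3⟩
  · rintro ⟨a, b, a', b', hm, hm', h1, h2, h3⟩
    exact ⟨((a : ℤ), (b : ℤ)), by simpa, ((a' : ℤ), (b' : ℤ)), by simpa, by simpa, by simpa, by simpa⟩

lemma IsSemistd.mono {μ : YoungDiagram} {f : ℕ → ℕ → ℕ} (h : IsSemistd μ f) {i j i' j' : ℕ}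
    (hm : (i', j') ∈ μ) (hi : i ≤ i') (hj : j ≤ j') : f i j ≤ f i' j' := by
  have h1 : f i j ≤ f i j' := by
    have hm' : (i, j') ∈ μ := μ.up_left_mem hi le_rfl hm
    clear hm
    induction j', hj using Nat.le_induction with
    | base => rfl
    | succ k hk ih => exact (ih (mem_of_right hm')).trans (h.2.1 i k hm')
  refine h1.trans ?_
  clear h1
  induction i', hi using Nat.le_induction with
  | base => rfl
  | succ k hk ih => exact (ih (mem_of_below hm)).trans (h.2.2 k j' hm).le

/-- `μ / ν` is a horizontal strip. -/
def IsHStrip (ν μ : YoungDiagram) : Prop :=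
  (∀ i j, (i, j) ∈ ν → (i, j) ∈ μ) ∧ ∀ i j, (i + 1, j) ∈ μ → (i, j) ∈ ν

/-- The diagram of the cells of `μ` where a semistandard filling is less than `k`. -/
def cut {μ : YoungDiagram} {f : ℕ → ℕ → ℕ} (h : IsSemistd μ f) (k : ℕ) : YoungDiagram where
  cells := μ.cells.filter fun c => f c.1 c.2 < k
  isLowerSet := by
    rintro ⟨i', j'⟩ ⟨i, j⟩ hle hm
    simp only [coe_filter, YoungDiagram.mem_cells, Set.mem_ofPred_eq] at hm ⊢
    exact ⟨μ.up_left_mem hle.1 hle.2 hm.1, (h.mono hm.1 hle.1 hle.2).trans_lt hm.2⟩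

lemma mem_cut {μ : YoungDiagram} {f : ℕ → ℕ → ℕ} (h : IsSemistd μ f) {k i j : ℕ} :
    (i, j) ∈ cut h k ↔ (i, j) ∈ μ ∧ f i j < k := by
  rw [← YoungDiagram.mem_cells]
  simp [cut]

/-- The restriction of a filling to `ν`, extended by zero. -/
def restrict (ν : YoungDiagram) (f : ℕ → ℕ → ℕ) (i j : ℕ) : ℕ :=
  if (i, j) ∈ ν then f i j else 0

/-- The filling of `μ` that is `f` on `ν` and `g` on the cells outside of `ν`. -/
def glue (ν μ : YoungDiagram) (f g : ℕ → ℕ → ℕ) (i j : ℕ) : ℕ :=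
  if (i, j) ∈ ν then f i j else if (i, j) ∈ μ then g i j else 0

lemma IsSemistd.restrict {μ ν : YoungDiagram} {f : ℕ → ℕ → ℕ} (h : IsSemistd μ f)
    (hν : ∀ i j, (i, j) ∈ ν → (i, j) ∈ μ) : IsSemistd ν (restrict ν f) := by
  refine ⟨fun i j hm => if_neg hm, fun i j hm => ?_, fun i j hm => ?_⟩
  · rw [RibbonSchur.restrict, RibbonSchur.restrict, if_pos hm, if_pos (mem_of_right hm)]
    exact h.2.1 i j (hν _ _ hm)
  · rw [RibbonSchur.restrict, RibbonSchur.restrict, if_pos hm, if_pos (mem_of_below hm)]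
    exact h.2.2 i j (hν _ _ hm)

lemma IsSemistd.glue {ν μ : YoungDiagram} {f g : ℕ → ℕ → ℕ} (h : IsSemistd ν f)
    (hs : IsHStrip ν μ) (k : ℕ) (hf : ∀ i j, (i, j) ∈ ν → f i j < k)
    (hg : ∀ i j, (i, j) ∈ μ → (i, j) ∉ ν → k ≤ g i j)
    (hg' : ∀ i j, (i, j + 1) ∈ μ → (i, j) ∉ ν → g i j ≤ g i (j + 1)) :
    IsSemistd μ (glue ν μ f g) := by
  refine ⟨fun i j hm => ?_, fun i j hm => ?_, fun i j hm => ?_⟩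
  · rw [RibbonSchur.glue, if_neg (fun h => hm (hs.1 _ _ h)), if_neg hm]
  · by_cases h2 : (i, j + 1) ∈ ν
    · rw [RibbonSchur.glue, RibbonSchur.glue, if_pos h2, if_pos (mem_of_right h2)]
      exact h.2.1 i j h2
    · by_cases h1 : (i, j) ∈ ν
      · rw [RibbonSchur.glue, RibbonSchur.glue, if_pos h1, if_neg h2, if_pos hm]
        exact (hf i j h1).le.trans (hg _ _ hm h2)
      · rw [RibbonSchur.glue, RibbonSchur.glue, if_neg h1, if_neg h2, if_pos hm,
          if_pos (mem_of_right hm)]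
        exact hg' i j hm h1
  · have h1 := hs.2 i j hm
    by_cases h2 : (i + 1, j) ∈ ν
    · rw [RibbonSchur.glue, RibbonSchur.glue, if_pos h2, if_pos h1]
      exact h.2.2 i j h2
    · rw [RibbonSchur.glue, RibbonSchur.glue, if_pos h1, if_neg h2, if_pos hm]
      exact (hf i j h1).trans_le (hg _ _ hm h2)

/-! ### Finiteness -/

lemma cells_injective : Function.Injective YoungDiagram.cells := by
  rintro ⟨a, _⟩ ⟨b, _⟩ h
  simpa using h

lemma finite_hStrip (μ : YoungDiagram) : {ν | IsHStrip ν μ}.Finite := by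
  refine Set.Finite.of_finite_image (f := YoungDiagram.cells) ?_ cells_injective.injOn
  refine (finite_toSet μ.cells.powerset).subset ?_
  rintro _ ⟨ν, hν, rfl⟩
  simp only [coe_powerset, Set.mem_preimage, Set.mem_powerset_iff, coe_subset]
  rintro ⟨i, j⟩ h
  exact hν.1 i j h

lemma add_lt_card {μ : YoungDiagram} {i j : ℕ} (h : (i, j) ∈ μ) : i < μ.card ∧ j < μ.card := by
  constructor
  · have : (range (i + 1)).image (fun k => (k, j)) ⊆ μ.cells := by
      intro c hc
      obtain ⟨k, hk, rfl⟩ := mem_image.1 hc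
      exact μ.up_left_mem (by simpa [Nat.lt_succ_iff] using hk) le_rfl h
    have := card_le_card this
    rw [card_image_of_injective _ (fun a b h => by simpa using h), card_range] at this
    exact this
  · have : (range (j + 1)).image (fun k => (i, k)) ⊆ μ.cells := by
      intro c hc
      obtain ⟨k, hk, rfl⟩ := mem_image.1 hc
      exact μ.up_left_mem le_rfl (by simpa [Nat.lt_succ_iff] using hk) h
    have := card_le_card this
    rw [card_image_of_injective _ (fun a b h => by simpa using h), card_range] at this
    exact this

lemma finite_card_eq (n : ℕ) : {μ : YoungDiagram | μ.card = n}.Finite := by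
  refine Set.Finite.of_finite_image (f := YoungDiagram.cells) ?_ cells_injective.injOn
  refine (finite_toSet (range n ×ˢ range n).powerset).subset ?_
  rintro _ ⟨μ, rfl, rfl⟩
  simp only [coe_powerset, Set.mem_preimage, Set.mem_powerset_iff, coe_subset]
  rintro ⟨i, j⟩ h
  simpa using add_lt_card h

lemma finite_semistd (N : ℕ) (μ : YoungDiagram) :
    {f : ℕ → ℕ → ℕ | IsSemistd μ f ∧ ∀ i j, (i, j) ∈ μ → f i j < N}.Finite := by
  refine Set.Finite.of_finite_image (f := fun f (c : μ.cells) => f c.1.1 c.1.2) ?_ ?_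
  · refine (finite_toSet (Fintype.piFinset fun _ : μ.cells => range N)).subset ?_
    rintro _ ⟨f, hf, rfl⟩
    simp only [mem_coe, Fintype.mem_piFinset, mem_range]
    rintro ⟨⟨i, j⟩, h⟩
    exact hf.2 i j h
  · intro f hf g hg h
    funext i j
    by_cases hm : (i, j) ∈ μ
    · exact congrFun h ⟨(i, j), hm⟩
    · rw [hf.1.1 i j hm, hg.1.1 i j hm]

/-! ### Schur polynomials and branching -/

open MvPolynomial in
/-- The Schur polynomial of `μ` in the first `N` variables. -/
noncomputable def schurPoly (N : ℕ) (μ : YoungDiagram) : MvPolynomial ℕ ℤ :=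
  ∑ f ∈ (finite_semistd N μ).toFinset, ∏ c ∈ μ.cells, X (f c.1 c.2)

/-- The diagrams obtained from `μ` by removing a horizontal strip. -/
noncomputable def below (μ : YoungDiagram) : Finset YoungDiagram := (finite_hStrip μ).toFinset

lemma mem_below {ν μ : YoungDiagram} : ν ∈ below μ ↔ IsHStrip ν μ := by simp [below]

lemma isHStrip_cut {μ : YoungDiagram} {N : ℕ} {f : ℕ → ℕ → ℕ} (h : IsSemistd μ f)
    (hN : ∀ i j, (i, j) ∈ μ → f i j < N + 1) : IsHStrip (cut h N) μ := by
  refine ⟨fun i j hm => ((mem_cut h).1 hm).1, fun i j hm => (mem_cut h).2 ⟨mem_of_below hm, ?_⟩⟩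
  have := h.2.2 i j hm
  have := hN _ _ hm
  omega

lemma IsHStrip.subset {ν μ : YoungDiagram} (h : IsHStrip ν μ) : ν.cells ⊆ μ.cells := by
  rintro ⟨i, j⟩ hm
  exact h.1 i j hm

lemma glue_restrict {μ ν : YoungDiagram} {f g : ℕ → ℕ → ℕ} (h : IsSemistd μ f)
    (hg : ∀ i j, (i, j) ∈ μ → (i, j) ∉ ν → g i j = f i j) :
    glue ν μ (restrict ν f) g = f := by
  funext i j
  by_cases h1 : (i, j) ∈ ν
  · simp [glue, restrict, h1]
  · by_cases h2 : (i, j) ∈ μ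
    · simp [glue, h1, h2, hg i j h2 h1]
    · simp [glue, h1, h2, h.1 i j h2]

lemma restrict_glue {μ ν : YoungDiagram} {f g : ℕ → ℕ → ℕ}
    (hf : ∀ i j, (i, j) ∉ ν → f i j = 0) : restrict ν (glue ν μ f g) = f := by
  funext i j
  by_cases h1 : (i, j) ∈ ν
  · simp [glue, restrict, h1]
  · simp [restrict, h1, hf i j h1]

lemma cut_glue {ν μ : YoungDiagram} {f g : ℕ → ℕ → ℕ} {k : ℕ} (hs : IsHStrip ν μ)
    (hf : ∀ i j, (i, j) ∈ ν → f i j < k) (hg : ∀ i j, (i, j) ∈ μ → (i, j) ∉ ν → k ≤ g i j)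
    (h : IsSemistd μ (glue ν μ f g)) : cut h k = ν := by
  apply cells_injective
  ext ⟨i, j⟩
  rw [YoungDiagram.mem_cells, YoungDiagram.mem_cells, mem_cut]
  constructor
  · rintro ⟨h1, h2⟩
    by_contra h3
    rw [glue, if_neg h3, if_pos h1] at h2
    exact absurd (hg i j h1 h3) (by omega)
  · intro h1
    refine ⟨hs.1 _ _ h1, ?_⟩
    rw [glue, if_pos h1]
    exact hf i j h1

open MvPolynomial in
lemma schurPoly_succ (N : ℕ) (μ : YoungDiagram) :
    schurPoly (N + 1) μ =
      ∑ ν ∈ below μ, schurPoly N ν * (X N : MvPolynomial ℕ ℤ) ^ (μ.card - ν.card) := by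
  simp only [schurPoly, sum_mul]
  rw [sum_sigma']
  refine sum_bij' (fun f hf => ⟨cut (((finite_semistd _ _).mem_toFinset.1 hf).1) N,
      restrict (cut (((finite_semistd _ _).mem_toFinset.1 hf).1) N) f⟩)
    (fun p _ => glue p.1 μ p.2 fun _ _ => N) ?_ ?_ ?_ ?_ ?_
  · intro f hf
    have hf' := (finite_semistd _ _).mem_toFinset.1 hf
    have hs := isHStrip_cut hf'.1 hf'.2
    simp only [mem_sigma, mem_below, Set.Finite.mem_toFinset, Set.mem_ofPred_eq]
    refine ⟨hs, hf'.1.restrict hs.1, fun i j hm => ?_⟩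
    rw [restrict, if_pos hm]
    exact ((mem_cut _).1 hm).2
  · rintro ⟨ν, f⟩ hp
    simp only [mem_sigma, mem_below, Set.Finite.mem_toFinset, Set.mem_ofPred_eq] at hp ⊢
    obtain ⟨hs, h, hN⟩ := hp
    refine ⟨h.glue hs N hN (fun _ _ _ _ => le_rfl) (fun _ _ _ _ => le_rfl), fun i j hm => ?_⟩
    rw [glue]
    split_ifs with h1
    · exact (hN i j h1).trans N.lt_succ_self
    · exact N.lt_succ_self
  · intro f hf
    have hf' := (finite_semistd _ _).mem_toFinset.1 hf
    have hs := isHStrip_cut hf'.1 hf'.2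
    refine glue_restrict hf'.1 fun i j h1 h2 => ?_
    rw [mem_cut] at h2
    have := hf'.2 i j h1
    have : ¬ f i j < N := fun h => h2 ⟨h1, h⟩
    omega
  · rintro ⟨ν, f⟩ hp
    simp only [mem_sigma, mem_below, Set.Finite.mem_toFinset, Set.mem_ofPred_eq] at hp
    obtain ⟨hs, h, hN⟩ := hp
    have hg := h.glue hs N hN (fun _ _ _ _ => le_rfl) (fun _ _ _ _ => le_rfl)
    have e := cut_glue hs hN (fun _ _ _ _ => le_rfl) hg
    simp only [e, restrict_glue h.1]
  · intro f hf
    have hf' := (finite_semistd _ _).mem_toFinset.1 hf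
    have hs := isHStrip_cut hf'.1 hf'.2
    rw [← prod_sdiff hs.subset, mul_comm]
    congr 1
    · refine prod_congr rfl ?_
      rintro ⟨i, j⟩ hm
      simp only [restrict]
      rw [if_pos (by simpa using hm)]
    · refine (prod_congr rfl (g := fun _ => X N) ?_).trans ?_
      swap
      · rw [prod_const, card_sdiff_of_subset hs.subset]
      rintro ⟨i, j⟩ hm
      rw [mem_sdiff, YoungDiagram.mem_cells, YoungDiagram.mem_cells, mem_cut] at hm
      have h1 := hf'.2 i j hm.1
      have : ¬ f i j < N := fun h => hm.2 ⟨hm.1, h⟩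
      have : f i j = N := by omega
      simp only [this]

lemma card_bot : (⊥ : YoungDiagram).card = 0 := by
  simp [YoungDiagram.card]

lemma schurPoly_bot (N : ℕ) : schurPoly N ⊥ = 1 := by
  have : (finite_semistd N ⊥).toFinset = {fun _ _ => 0} := by
    ext f
    simp only [Set.Finite.mem_toFinset, Set.mem_ofPred_eq, mem_singleton]
    constructor
    · intro h
      funext i j
      exact h.1.1 i j (YoungDiagram.notMem_bot _)
    · rintro rfl
      simp [IsSemistd, YoungDiagram.notMem_bot]
  rw [schurPoly, this]
  simp

lemma schurPoly_zero {μ : YoungDiagram} (h : μ.card ≠ 0) : schurPoly 0 μ = 0 := by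
  have : (finite_semistd 0 μ).toFinset = ∅ := by
    rw [eq_empty_iff_forall_notMem]
    intro f hf
    rw [Set.Finite.mem_toFinset] at hf
    apply h
    rw [YoungDiagram.card, card_eq_zero, eq_empty_iff_forall_notMem]
    rintro ⟨i, j⟩ hm
    exact absurd (hf.2 i j hm) (by omega)
  rw [schurPoly, this, sum_empty]

/-! ### Cutting standard tableaux -/

lemma IsHStrip.row_le {ν μ : YoungDiagram} (h : IsHStrip ν μ) {c c' : ℕ × ℕ}
    (hc : c ∈ μ.cells \ ν.cells) (hc' : c' ∈ μ.cells \ ν.cells) (hle : c.2 ≤ c'.2) :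
    c'.1 ≤ c.1 := by
  by_contra hlt
  rw [mem_sdiff] at hc hc'
  exact hc.2 (h.2 c.1 c.2 (μ.up_left_mem (by omega) hle hc'.1))

lemma IsHStrip.eq_of_col_eq {ν μ : YoungDiagram} (h : IsHStrip ν μ) {c c' : ℕ × ℕ}
    (hc : c ∈ μ.cells \ ν.cells) (hc' : c' ∈ μ.cells \ ν.cells) (he : c.2 = c'.2) : c = c' :=
  Prod.ext (le_antisymm (h.row_le hc' hc he.ge) (h.row_le hc hc' he.le)) he

/-- The number of cells of `μ / ν` in the columns up to `j`. -/
def colRank (ν μ : YoungDiagram) (j : ℕ) : ℕ := #{c ∈ μ.cells \ ν.cells | c.2 ≤ j}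

lemma colRank_mono (ν μ : YoungDiagram) : Monotone (colRank ν μ) := fun _ _ h =>
  card_le_card fun c hc => by
    rw [mem_filter] at hc ⊢
    exact ⟨hc.1, hc.2.trans h⟩

lemma colRank_pos {ν μ : YoungDiagram} {i j : ℕ} (h1 : (i, j) ∈ μ) (h2 : (i, j) ∉ ν) :
    0 < colRank ν μ j :=
  card_pos.2 ⟨(i, j), by simp [h1, h2]⟩

lemma colRank_lt {ν μ : YoungDiagram} {i j k : ℕ} (h1 : (i, j) ∈ μ) (h2 : (i, j) ∉ ν)
    (h : k < j) : colRank ν μ k < colRank ν μ j := by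
  refine card_lt_card ((ssubset_iff_of_subset fun c hc => ?_).2 ⟨(i, j), ?_, ?_⟩)
  · rw [mem_filter] at hc ⊢
    exact ⟨hc.1, by omega⟩
  · simp [h1, h2]
  · simp [h]

lemma colRank_le (ν μ : YoungDiagram) (j : ℕ) : colRank ν μ j ≤ #(μ.cells \ ν.cells) :=
  card_filter_le _ _

/-- The standard fillings of `μ` whose descents in `[1, n - 1] \ {s}` are the elements of `S`
there. -/
def stdDesc (μ : YoungDiagram) (n s : ℕ) (S : Finset ℕ) : Set (ℕ → ℕ → ℕ) :=
  {f | IsStd μ n f ∧ ∀ i, 1 ≤ i → i < n → i ≠ s → (IsDesc μ f i ↔ i ∈ S)}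

lemma finite_stdDesc (μ : YoungDiagram) (n s : ℕ) (S : Finset ℕ) : (stdDesc μ n s S).Finite := by
  refine (finite_semistd (n + 1) μ).subset fun f hf => ⟨hf.1.1, fun i j hm => ?_⟩
  exact Nat.lt_succ_of_le (hf.1.2.mapsTo (x := (i, j)) hm).2

lemma IsStd.card_filter {μ : YoungDiagram} {n : ℕ} {f : ℕ → ℕ → ℕ} (h : IsStd μ n f) {a b : ℕ}
    (hb : b ≤ n) : #{c ∈ μ.cells | a < f c.1 c.2 ∧ f c.1 c.2 ≤ b} = b - a := by
  rw [← Nat.card_Ioc]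
  refine card_nbij (fun c => f c.1 c.2) (fun c hc => ?_) (fun c hc c' hc' he => ?_)
    (fun k hk => ?_)
  · simp only [mem_coe, mem_filter, mem_Ioc] at hc ⊢
    exact hc.2
  · simp only [coe_filter, Set.mem_ofPred_eq] at hc hc'
    exact h.2.injOn hc.1 hc'.1 he
  · simp only [coe_Ioc, Set.mem_Ioc] at hk
    obtain ⟨c, hc, rfl⟩ := h.2.surjOn (show k ∈ Set.Icc 1 n from ⟨by omega, by omega⟩)
    exact ⟨c, by simpa using ⟨hc, hk⟩, rfl⟩

lemma IsStd.pos {μ : YoungDiagram} {n : ℕ} {f : ℕ → ℕ → ℕ} (h : IsStd μ n f) {i j : ℕ}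
    (hm : (i, j) ∈ μ) : 1 ≤ f i j := (h.2.mapsTo (x := (i, j)) hm).1

lemma IsStd.le {μ : YoungDiagram} {n : ℕ} {f : ℕ → ℕ → ℕ} (h : IsStd μ n f) {i j : ℕ}
    (hm : (i, j) ∈ μ) : f i j ≤ n := (h.2.mapsTo (x := (i, j)) hm).2

lemma IsStd.card_cut {μ : YoungDiagram} {n s : ℕ} {f : ℕ → ℕ → ℕ} (h : IsStd μ n f) (hs : s ≤ n) :
    (cut h.1 (s + 1)).card = s := by
  refine Eq.trans (congrArg card (filter_congr ?_)) (h.card_filter (a := 0) hs)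
  rintro ⟨i, j⟩ hm
  have := h.pos hm
  simp only
  omega

lemma IsStd.row_le {μ : YoungDiagram} {n s : ℕ} {f : ℕ → ℕ → ℕ} (h : IsStd μ n f)
    (hd : ∀ i, s < i → i < n → ¬ IsDesc μ f i) {c : ℕ × ℕ} (hc : c ∈ μ) (hsc : s < f c.1 c.2)
    {c' : ℕ × ℕ} (hc' : c' ∈ μ) (hle : f c.1 c.2 ≤ f c'.1 c'.2) : c'.1 ≤ c.1 := by
  obtain ⟨t, ht⟩ : ∃ t, t = f c'.1 c'.2 := ⟨_, rfl⟩
  rw [← ht] at hle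
  induction t, hle using Nat.le_induction generalizing c' with
  | base => rw [h.2.injOn hc hc' ht]
  | succ t hct ih =>
    have hn := h.le (i := c'.1) (j := c'.2) hc'
    obtain ⟨c'', hc'', he⟩ := h.2.surjOn (show t ∈ Set.Icc 1 n from ⟨by omega, by omega⟩)
    refine le_trans ?_ (ih hc'' he.symm)
    by_contra hlt
    exact hd t (by omega) (by omega) ⟨_, _, _, _, hc'', hc', he, ht.symm, by omega⟩

lemma IsStd.col_le {μ : YoungDiagram} {n s : ℕ} {f : ℕ → ℕ → ℕ} (h : IsStd μ n f)
    (hd : ∀ i, s < i → i < n → ¬ IsDesc μ f i) {c : ℕ × ℕ} (hc : c ∈ μ) (hsc : s < f c.1 c.2)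
    {c' : ℕ × ℕ} (hc' : c' ∈ μ) (hle : f c.1 c.2 ≤ f c'.1 c'.2) : c.2 ≤ c'.2 := by
  by_contra hlt
  have := h.row_le hd hc hsc hc' hle
  have h2 := h.1.mono (i := c'.1) (j := c'.2) (i' := c.1) (j' := c.2) hc this (by omega)
  have := h.2.injOn hc hc' (le_antisymm hle h2)
  subst this
  omega

lemma IsStd.isHStrip_cut {μ : YoungDiagram} {n s : ℕ} {f : ℕ → ℕ → ℕ} (h : IsStd μ n f)
    (hd : ∀ i, s < i → i < n → ¬ IsDesc μ f i) : IsHStrip (cut h.1 (s + 1)) μ := by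
  refine ⟨fun i j hm => ((mem_cut h.1).1 hm).1,
    fun i j hm => (mem_cut h.1).2 ⟨mem_of_below hm, ?_⟩⟩
  by_contra hlt
  have := h.row_le hd (c := (i, j)) (mem_of_below hm) (by simp only; omega) (c' := (i + 1, j)) hm
    (h.1.2.2 i j hm).le
  simp only at this
  omega

lemma IsStd.eq_add_colRank {μ : YoungDiagram} {n s : ℕ} {f : ℕ → ℕ → ℕ} (h : IsStd μ n f)
    (hd : ∀ i, s < i → i < n → ¬ IsDesc μ f i) {i j : ℕ} (hm : (i, j) ∈ μ)
    (hm' : (i, j) ∉ cut h.1 (s + 1)) : s + colRank (cut h.1 (s + 1)) μ j = f i j := by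
  have hst := h.isHStrip_cut hd
  have key : ∀ a b, (a, b) ∈ μ → ((a, b) ∉ cut h.1 (s + 1) ↔ s < f a b) := fun a b hab => by
    rw [mem_cut, not_and, not_lt]
    exact ⟨fun h => h hab, fun h _ => h⟩
  have hs := (key i j hm).1 hm'
  have : colRank (cut h.1 (s + 1)) μ j = f i j - s := by
    rw [← h.card_filter (h.le hm), colRank]
    congr 1
    ext ⟨a, b⟩
    simp only [mem_filter, mem_sdiff, YoungDiagram.mem_cells]
    constructor
    · rintro ⟨⟨h1, h2⟩, h3⟩
      have h4 := (key a b h1).1 h2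
      refine ⟨h1, h4, ?_⟩
      by_contra hlt
      have h5 := h.col_le hd (c := (i, j)) (c' := (a, b)) hm hs h1 (by simp only; omega)
      have := hst.eq_of_col_eq (c := (i, j)) (c' := (a, b)) (by simp [hm, hm'])
        (by simp [h1, h2]) (le_antisymm h5 h3)
      simp only [Prod.mk.injEq] at this
      rw [this.1, this.2] at hlt
      exact hlt le_rfl
    · rintro ⟨h1, h2, h3⟩
      exact ⟨⟨h1, (key a b h1).2 h2⟩, h.col_le hd (c := (a, b)) (c' := (i, j)) h1 h2 hm h3⟩
  omega

lemma IsStd.isDesc_cut {μ : YoungDiagram} {f : ℕ → ℕ → ℕ} (h : IsSemistd μ f) {i s : ℕ}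
    (hi : i < s) : IsDesc (cut h (s + 1)) (restrict (cut h (s + 1)) f) i ↔ IsDesc μ f i := by
  constructor
  · rintro ⟨a, b, a', b', hm, hm', h1, h2, h3⟩
    rw [restrict, if_pos hm] at h1
    rw [restrict, if_pos hm'] at h2
    exact ⟨a, b, a', b', ((mem_cut h).1 hm).1, ((mem_cut h).1 hm').1, h1, h2, h3⟩
  · rintro ⟨a, b, a', b', hm, hm', h1, h2, h3⟩
    have e : (a, b) ∈ cut h (s + 1) := (mem_cut h).2 ⟨hm, by omega⟩
    have e' : (a', b') ∈ cut h (s + 1) := (mem_cut h).2 ⟨hm', by omega⟩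
    exact ⟨a, b, a', b', e, e', by rwa [restrict, if_pos e], by rwa [restrict, if_pos e'], h3⟩

lemma IsStd.restrict_cut {μ : YoungDiagram} {n s : ℕ} {f : ℕ → ℕ → ℕ} (h : IsStd μ n f)
    (hs : s ≤ n) : IsStd (cut h.1 (s + 1)) s (restrict (cut h.1 (s + 1)) f) := by
  refine ⟨h.1.restrict fun i j hm => ((mem_cut h.1).1 hm).1, ?_, ?_, ?_⟩
  · rintro ⟨i, j⟩ hm
    have hm' : (i, j) ∈ cut h.1 (s + 1) := hm
    have := (mem_cut h.1).1 hm'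
    simp only [restrict, if_pos hm']
    exact ⟨h.pos this.1, Nat.lt_succ_iff.1 this.2⟩
  · rintro ⟨i, j⟩ hm ⟨i', j'⟩ hm' he
    have e : (i, j) ∈ cut h.1 (s + 1) := hm
    have e' : (i', j') ∈ cut h.1 (s + 1) := hm'
    simp only [restrict, if_pos e, if_pos e'] at he
    exact h.2.injOn ((mem_cut h.1).1 e).1 ((mem_cut h.1).1 e').1 he
  · rintro k ⟨hk, hk'⟩
    obtain ⟨⟨i, j⟩, hc, he⟩ := h.2.surjOn (show k ∈ Set.Icc 1 n from ⟨hk, by omega⟩)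
    simp only at he
    have e : (i, j) ∈ cut h.1 (s + 1) := (mem_cut h.1).2 ⟨hc, by omega⟩
    exact ⟨(i, j), e, by simp only [restrict, if_pos e, he]⟩

lemma isSemistd_glue_colRank {ν μ : YoungDiagram} {s : ℕ} {f : ℕ → ℕ → ℕ} (h : IsStd ν s f)
    (hs : IsHStrip ν μ) : IsSemistd μ (glue ν μ f fun _ j => s + colRank ν μ j) :=
  h.1.glue hs (s + 1) (fun _ _ hm => Nat.lt_succ_iff.2 (h.le hm))
    (fun _ _ h1 h2 => Nat.add_le_add_left (colRank_pos h1 h2) s)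
    (fun _ j _ _ => Nat.add_le_add_left (colRank_mono ν μ j.le_succ) s)

lemma isStd_glue {ν μ : YoungDiagram} {s n : ℕ} {f : ℕ → ℕ → ℕ} (h : IsStd ν s f)
    (hs : IsHStrip ν μ) (hν : ν.card = s) (hμ : μ.card = n) :
    IsStd μ n (glue ν μ f fun _ j => s + colRank ν μ j) := by
  have hcard : #(μ.cells \ ν.cells) = n - s := by
    rw [card_sdiff_of_subset hs.subset, ← hν, ← hμ]
  have hsn : s ≤ n := by
    rw [← hν, ← hμ]
    exact card_le_card hs.subset
  have hmaps : Set.MapsTo (fun c : ℕ × ℕ => glue ν μ f (fun _ j => s + colRank ν μ j) c.1 c.2)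
      μ.cells (Finset.Icc 1 n) := by
    rintro ⟨i, j⟩ hm
    have hm' : (i, j) ∈ μ := hm
    simp only [glue, coe_Icc, Set.mem_Icc, if_pos hm']
    split_ifs with h1
    · exact ⟨h.pos h1, (h.le h1).trans hsn⟩
    · have := colRank_pos hm' h1
      have := colRank_le ν μ j
      omega
  have hinj : Set.InjOn (fun c : ℕ × ℕ => glue ν μ f (fun _ j => s + colRank ν μ j) c.1 c.2)
      μ.cells := by
    rintro ⟨i, j⟩ hm ⟨i', j'⟩ hm' he
    have e : (i, j) ∈ μ := hm
    have e' : (i', j') ∈ μ := hm'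
    simp only [glue, if_pos e, if_pos e'] at he
    split_ifs at he with h1 h2 h2
    · exact h.2.injOn h1 h2 he
    · have := h.le h1
      have := colRank_pos e' h2
      omega
    · have := h.le h2
      have := colRank_pos e h1
      omega
    · have hj : j = j' := by
        rcases lt_trichotomy j j' with hlt | rfl | hlt
        · have := colRank_lt e' h2 hlt
          omega
        · rfl
        · have := colRank_lt e h1 hlt
          omega
      exact hs.eq_of_col_eq (by simp [e, h1]) (by simp [e', h2]) hj
  refine ⟨isSemistd_glue_colRank h hs, ?_⟩
  rw [← coe_Icc]
  refine ⟨hmaps, hinj, surjOn_of_injOn_of_card_le _ hmaps hinj ?_⟩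
  rw [Nat.card_Icc, ← hμ]
  simp [YoungDiagram.card]

lemma not_isDesc_glue {ν μ : YoungDiagram} {s i : ℕ} {f : ℕ → ℕ → ℕ} (h : IsStd ν s f)
    (hs : IsHStrip ν μ) (hi : s < i) :
    ¬ IsDesc μ (glue ν μ f fun _ j => s + colRank ν μ j) i := by
  rintro ⟨a, b, a', b', hm, hm', h1, h2, h3⟩
  simp only [glue, if_pos hm] at h1
  simp only [glue, if_pos hm'] at h2
  have e : (a, b) ∉ ν := fun e => by
    rw [if_pos e] at h1
    have := h.le e
    omega
  have e' : (a', b') ∉ ν := fun e => by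
    rw [if_pos e] at h2
    have := h.le e
    omega
  rw [if_neg e] at h1
  rw [if_neg e'] at h2
  have hb : b ≤ b' := by
    by_contra hlt
    have := colRank_mono ν μ (show b' ≤ b by omega)
    omega
  have := hs.row_le (c := (a, b)) (c' := (a', b')) (by simp [hm, e]) (by simp [hm', e']) hb
  simp only at this
  omega

lemma ncard_stdDesc {μ : YoungDiagram} {n s : ℕ} {S : Finset ℕ} (hμ : μ.card = n) (hsn : s ≤ n)
    (hS : ∀ i ∈ S, i < s) :
    (stdDesc μ n s S).ncard = ∑ ν ∈ below μ with ν.card = s, (stdDesc ν s s S).ncard := by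
  simp only [Set.ncard_eq_toFinset_card _ (finite_stdDesc _ _ _ _)]
  rw [← card_sigma]
  have nd : ∀ f ∈ stdDesc μ n s S, ∀ i, s < i → i < n → ¬ IsDesc μ f i := by
    intro f hf i h1 h2 hd
    have := hS i ((hf.2 i (by omega) h2 (by omega)).1 hd)
    omega
  refine card_bij' (fun f hf => ⟨cut ((finite_stdDesc _ _ _ _).mem_toFinset.1 hf).1.1 (s + 1),
      restrict (cut ((finite_stdDesc _ _ _ _).mem_toFinset.1 hf).1.1 (s + 1)) f⟩)
    (fun p _ => glue p.1 μ p.2 fun _ j => s + colRank p.1 μ j) ?_ ?_ ?_ ?_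
  · intro f hf
    have hf' := (finite_stdDesc _ _ _ _).mem_toFinset.1 hf
    refine mem_sigma.2 ⟨mem_filter.2 ⟨mem_below.2 (hf'.1.isHStrip_cut (nd f hf')),
      hf'.1.card_cut hsn⟩, (Set.Finite.mem_toFinset _).2 ⟨hf'.1.restrict_cut hsn,
      fun i h1 h2 _ => ?_⟩⟩
    rw [IsStd.isDesc_cut _ h2]
    exact hf'.2 i h1 (by omega) (by omega)
  · rintro ⟨ν, f⟩ hp
    rw [mem_sigma, mem_filter, mem_below, Set.Finite.mem_toFinset] at hp
    obtain ⟨⟨hs, hν⟩, h, hd⟩ := hp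
    simp only at hs hν h hd
    rw [Set.Finite.mem_toFinset]
    refine ⟨isStd_glue h hs hν hμ, fun i h1 h2 h3 => ?_⟩
    rcases lt_or_gt_of_ne h3 with h4 | h4
    · rw [← hd i h1 h4 (by omega), ← IsStd.isDesc_cut (isSemistd_glue_colRank h hs) h4,
        cut_glue hs (fun _ _ hm => Nat.lt_succ_iff.2 (h.le hm))
          (fun _ _ h1 h2 => Nat.add_le_add_left (colRank_pos h1 h2) s), restrict_glue h.1.1]
    · refine iff_of_false (not_isDesc_glue h hs h4) fun hi => ?_
      have := hS i hi
      omega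
  · intro f hf
    have hf' := (finite_stdDesc _ _ _ _).mem_toFinset.1 hf
    exact glue_restrict hf'.1.1 fun i j h1 h2 => hf'.1.eq_add_colRank (nd f hf') h1 h2
  · rintro ⟨ν, f⟩ hp
    rw [mem_sigma, mem_filter, mem_below, Set.Finite.mem_toFinset] at hp
    obtain ⟨⟨hs, hν⟩, h, hd⟩ := hp
    simp only at hs hν h hd
    have e := cut_glue hs (fun _ _ hm => Nat.lt_succ_iff.2 (h.le hm))
          (fun _ _ h1 h2 => Nat.add_le_add_left (colRank_pos h1 h2) s)
          (isSemistd_glue_colRank h hs)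
    simp only [e, restrict_glue h.1.1]

/-! ### The Pieri rule -/

lemma eq_of_rowLen_eq {μ ν : YoungDiagram} (h : ∀ i, μ.rowLen i = ν.rowLen i) : μ = ν := by
  apply cells_injective
  ext ⟨i, j⟩
  rw [YoungDiagram.mem_cells, YoungDiagram.mem_cells, YoungDiagram.mem_iff_lt_rowLen,
    YoungDiagram.mem_iff_lt_rowLen, h]

lemma rowLen_eq_zero {μ : YoungDiagram} {i : ℕ} (h : μ.card ≤ i) : μ.rowLen i = 0 := by
  by_contra h0
  have := (add_lt_card (YoungDiagram.mem_iff_lt_rowLen.2 (Nat.pos_of_ne_zero h0))).1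
  omega

lemma card_eq_sum_rowLen {μ : YoungDiagram} {K : ℕ} (h : μ.card ≤ K) :
    μ.card = ∑ i ∈ range K, μ.rowLen i := by
  rw [YoungDiagram.card, card_eq_sum_card_fiberwise (f := Prod.fst) (t := range K)]
  · exact sum_congr rfl fun i _ => (μ.rowLen_eq_card).symm
  · rintro ⟨i, j⟩ hm
    have := add_lt_card (i := i) (j := j) hm
    simp only [coe_range, Set.mem_Iio]
    omega

lemma isHStrip_iff {ν μ : YoungDiagram} :
    IsHStrip ν μ ↔ ∀ i, ν.rowLen i ≤ μ.rowLen i ∧ μ.rowLen (i + 1) ≤ ν.rowLen i := by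
  simp only [IsHStrip, YoungDiagram.mem_iff_lt_rowLen]
  constructor
  · rintro ⟨h1, h2⟩ i
    refine ⟨?_, ?_⟩
    · by_contra hlt
      exact lt_irrefl _ (h1 i (μ.rowLen i) (by omega))
    · by_contra hlt
      exact lt_irrefl _ (h2 i (ν.rowLen i) (by omega))
  · intro h
    exact ⟨fun i j hj => hj.trans_le (h i).1, fun i j hj => hj.trans_le (h i).2⟩

/-- The largest Young diagram in the first `K` rows with row lengths bounded by `g`. -/
def ofRows (K : ℕ) (g : ℕ → ℕ) : YoungDiagram where
  cells := (range K ×ˢ range (g 0)).filter fun c => ∀ i ≤ c.1, c.2 < g i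
  isLowerSet := by
    rintro ⟨i', j'⟩ ⟨i, j⟩ ⟨h1, h2⟩ hm
    simp only [coe_filter, mem_product, mem_range, Set.mem_ofPred_eq] at hm h1 h2 ⊢
    exact ⟨⟨by omega, by omega⟩, fun k hk => h2.trans_lt (hm.2 k (by omega))⟩

lemma rowLen_ofRows {K : ℕ} {g : ℕ → ℕ} (hg : ∀ i, g (i + 1) ≤ g i) (hK : g K = 0) (i : ℕ) :
    (ofRows K g).rowLen i = g i := by
  have ha : Antitone g := antitone_nat_of_succ_le hg
  have key : ∀ j, j < (ofRows K g).rowLen i ↔ j < g i := fun j => by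
    rw [← YoungDiagram.mem_iff_lt_rowLen, ← YoungDiagram.mem_cells]
    simp only [ofRows, mem_filter, mem_product, mem_range]
    constructor
    · rintro ⟨-, h⟩
      exact h i le_rfl
    · intro h
      refine ⟨⟨?_, h.trans_le (ha (Nat.zero_le i))⟩, fun k hk => h.trans_le (ha hk)⟩
      by_contra hlt
      have := ha (not_lt.1 hlt)
      omega
  exact le_antisymm (not_lt.1 fun h => lt_irrefl _ ((key _).1 h))
    (not_lt.1 fun h => lt_irrefl _ ((key _).2 h))

/-- The local rule relating the four corners of a square of horizontal strips
`κ ⊆ ν, ρ ⊆ μ`, with an additional label `k`. -/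
def LocalRule (ν ρ μ κ : YoungDiagram) (k : ℕ) : Prop :=
  μ.rowLen 0 = max (ν.rowLen 0) (ρ.rowLen 0) + k ∧
  ∀ i, μ.rowLen (i + 1) + κ.rowLen i =
    max (ν.rowLen (i + 1)) (ρ.rowLen (i + 1)) + min (ν.rowLen i) (ρ.rowLen i)

/-- The lower corner determined by the local rule. -/
def lowerCorner (ν ρ μ : YoungDiagram) : YoungDiagram :=
  ofRows ν.card fun i => max (ν.rowLen (i + 1)) (ρ.rowLen (i + 1)) +
    min (ν.rowLen i) (ρ.rowLen i) - μ.rowLen (i + 1)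

/-- The row lengths of the upper corner determined by the local rule. -/
def upperRow (ν ρ κ : YoungDiagram) (k : ℕ) : ℕ → ℕ
  | 0 => max (ν.rowLen 0) (ρ.rowLen 0) + k
  | i + 1 => max (ν.rowLen (i + 1)) (ρ.rowLen (i + 1)) +
      min (ν.rowLen i) (ρ.rowLen i) - κ.rowLen i

/-- The upper corner determined by the local rule. -/
def upperCorner (ν ρ κ : YoungDiagram) (k : ℕ) : YoungDiagram :=
  ofRows (ν.card + ρ.card + 1) (upperRow ν ρ κ k)

lemma lowerCorner_spec {ν ρ μ : YoungDiagram} (h1 : IsHStrip ν μ) (h2 : IsHStrip ρ μ) :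
    LocalRule ν ρ μ (lowerCorner ν ρ μ) (μ.rowLen 0 - max (ν.rowLen 0) (ρ.rowLen 0)) ∧
      IsHStrip (lowerCorner ν ρ μ) ν ∧ IsHStrip (lowerCorner ν ρ μ) ρ := by
  rw [isHStrip_iff] at h1 h2
  have hrow : ∀ i, (lowerCorner ν ρ μ).rowLen i = max (ν.rowLen (i + 1)) (ρ.rowLen (i + 1)) +
      min (ν.rowLen i) (ρ.rowLen i) - μ.rowLen (i + 1) := by
    refine rowLen_ofRows (fun i => ?_) ?_
    · have := h1 i; have := h2 i
      have := h1 (i + 1); have := h2 (i + 1)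
      have := h1 (i + 1 + 1); have := h2 (i + 1 + 1)
      omega
    · have := h1 (ν.card + 1); have := h2 (ν.card + 1)
      have := rowLen_eq_zero (μ := ν) le_rfl
      omega
  refine ⟨⟨?_, fun i => ?_⟩, isHStrip_iff.2 fun i => ?_, isHStrip_iff.2 fun i => ?_⟩
  · have := h1 0; have := h2 0
    omega
  all_goals
    rw [hrow]
    have := h1 i; have := h2 i
    have := h1 (i + 1); have := h2 (i + 1)
    omega

lemma upperCorner_spec {ν ρ κ : YoungDiagram} (h1 : IsHStrip κ ν) (h2 : IsHStrip κ ρ) (k : ℕ) :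
    LocalRule ν ρ (upperCorner ν ρ κ k) κ k ∧
      IsHStrip ν (upperCorner ν ρ κ k) ∧ IsHStrip ρ (upperCorner ν ρ κ k) := by
  rw [isHStrip_iff] at h1 h2
  have anti : ∀ i, upperRow ν ρ κ k (i + 1) ≤ upperRow ν ρ κ k i := by
    rintro (_ | i)
    · have := h1 0; have := h2 0
      simp only [upperRow]
      omega
    · have := h1 i; have := h2 i
      have := h1 (i + 1); have := h2 (i + 1)
      simp only [upperRow]
      omega
  have hz : upperRow ν ρ κ k (ν.card + ρ.card + 1) = 0 := by
    have := rowLen_eq_zero (μ := ν) (i := ν.card + ρ.card + 1) (by omega)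
    have := rowLen_eq_zero (μ := ρ) (i := ν.card + ρ.card + 1) (by omega)
    have := rowLen_eq_zero (μ := ν) (i := ν.card + ρ.card) (by omega)
    simp only [upperRow]
    omega
  have hrow := rowLen_ofRows anti hz
  have hrow0 : (upperCorner ν ρ κ k).rowLen 0 = max (ν.rowLen 0) (ρ.rowLen 0) + k := hrow 0
  have hrow1 : ∀ i, (upperCorner ν ρ κ k).rowLen (i + 1) =
      max (ν.rowLen (i + 1)) (ρ.rowLen (i + 1)) +
        min (ν.rowLen i) (ρ.rowLen i) - κ.rowLen i := fun i => hrow (i + 1)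
  refine ⟨⟨hrow0, fun i => ?_⟩, isHStrip_iff.2 fun i => ⟨?_, ?_⟩, isHStrip_iff.2 fun i => ⟨?_, ?_⟩⟩
  · rw [hrow1]
    have := h1 i; have := h2 i
    omega
  · rcases i with _ | i
    · rw [hrow0]; omega
    · rw [hrow1]
      have := h1 i; have := h2 i
      omega
  · rw [hrow1]
    have := h1 i; have := h2 i
    omega
  · rcases i with _ | i
    · rw [hrow0]; omega
    · rw [hrow1]
      have := h1 i; have := h2 i
      omega
  · rw [hrow1]
    have := h1 i; have := h2 i
    omega

lemma LocalRule.lower_unique {ν ρ μ κ κ' : YoungDiagram} {k k' : ℕ} (h : LocalRule ν ρ μ κ k)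
    (h' : LocalRule ν ρ μ κ' k') : κ = κ' :=
  eq_of_rowLen_eq fun i => by
    have := h.2 i
    have := h'.2 i
    omega

lemma LocalRule.upper_unique {ν ρ μ μ' κ : YoungDiagram} {k : ℕ} (h : LocalRule ν ρ μ κ k)
    (h' : LocalRule ν ρ μ' κ k) : μ = μ' :=
  eq_of_rowLen_eq fun i => by
    rcases i with _ | i
    · exact h.1.trans h'.1.symm
    · have := h.2 i
      have := h'.2 i
      omega

lemma LocalRule.card_add {ν ρ μ κ : YoungDiagram} {k : ℕ} (h : LocalRule ν ρ μ κ k) :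
    μ.card + κ.card = k + ν.card + ρ.card := by
  have key : ∀ K, ∑ i ∈ range (K + 1), μ.rowLen i + ∑ i ∈ range K, κ.rowLen i +
      min (ν.rowLen K) (ρ.rowLen K) =
      k + ∑ i ∈ range (K + 1), ν.rowLen i + ∑ i ∈ range (K + 1), ρ.rowLen i := by
    intro K
    induction K with
    | zero =>
      have := h.1
      simp only [zero_add, sum_range_one, range_zero, sum_empty]
      omega
    | succ K ih =>
      have := h.2 K
      rw [sum_range_succ (fun i => μ.rowLen i) (K + 1), sum_range_succ (fun i => κ.rowLen i) K,
        sum_range_succ (fun i => ν.rowLen i) (K + 1), sum_range_succ (fun i => ρ.rowLen i) (K + 1)]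
      omega
  have := key (μ.card + κ.card + ν.card + ρ.card)
  rw [rowLen_eq_zero (μ := ν) (by omega), ← card_eq_sum_rowLen (by omega),
    ← card_eq_sum_rowLen (by omega), ← card_eq_sum_rowLen (by omega),
    ← card_eq_sum_rowLen (by omega)] at this
  omega

/-- The complete homogeneous polynomial of degree `b` in the first `N` variables. -/
noncomputable def hPoly : ℕ → ℕ → MvPolynomial ℕ ℤ
  | 0, b => if b = 0 then 1 else 0
  | N + 1, b => ∑ k ∈ range (b + 1), MvPolynomial.X N ^ k * hPoly N (b - k)

lemma finite_above (ν : YoungDiagram) (b : ℕ) :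
    {μ | IsHStrip ν μ ∧ μ.card = ν.card + b}.Finite :=
  (finite_card_eq (ν.card + b)).subset fun _ h => h.2

/-- The diagrams obtained from `ν` by adding a horizontal strip of size `b`. -/
noncomputable def above (ν : YoungDiagram) (b : ℕ) : Finset YoungDiagram :=
  (finite_above ν b).toFinset

lemma mem_above {ν μ : YoungDiagram} {b : ℕ} :
    μ ∈ above ν b ↔ IsHStrip ν μ ∧ μ.card = ν.card + b := by simp [above]

lemma IsHStrip.card_le {ν μ : YoungDiagram} (h : IsHStrip ν μ) : ν.card ≤ μ.card :=
  Finset.card_le_card h.subset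

lemma isHStrip_refl (ν : YoungDiagram) : IsHStrip ν ν :=
  ⟨fun _ _ h => h, fun _ _ h => mem_of_below h⟩

lemma above_zero (ν : YoungDiagram) : above ν 0 = {ν} := by
  ext μ
  rw [mem_above, mem_singleton]
  constructor
  · rintro ⟨h, hc⟩
    exact (cells_injective (eq_of_subset_of_card_le h.subset hc.le)).symm
  · rintro rfl
    exact ⟨isHStrip_refl _, rfl⟩

lemma sum_above_below (ν : YoungDiagram) (b : ℕ) {M : Type*} [AddCommMonoid M]
    (F : YoungDiagram → ℕ → M) :
    ∑ μ ∈ above ν b, ∑ ρ ∈ below μ, F ρ (μ.card - ρ.card) =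
      ∑ κ ∈ below ν, ∑ k ∈ range (b + 1), ∑ ρ ∈ above κ (b - k), F ρ (ν.card - κ.card + k) := by
  rw [sum_sigma']
  simp_rw [sum_sigma']
  refine sum_bij' (fun p _ => ⟨lowerCorner ν p.2 p.1,
        p.1.rowLen 0 - max (ν.rowLen 0) (p.2.rowLen 0), p.2⟩)
    (fun q _ => ⟨upperCorner ν q.2.2 q.1 q.2.1, q.2.2⟩) ?_ ?_ ?_ ?_ ?_
  · rintro ⟨μ, ρ⟩ hp
    obtain ⟨h1, h2⟩ := mem_sigma.1 hp
    obtain ⟨h1, hc⟩ := mem_above.1 h1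
    have h2 := mem_below.1 h2
    obtain ⟨hr, h3, h4⟩ := lowerCorner_spec h1 h2
    have := hr.card_add
    have := h4.card_le
    simp only at *
    refine mem_sigma.2 ⟨mem_below.2 h3, mem_sigma.2 ⟨mem_range.2 ?_, mem_above.2 ⟨h4, ?_⟩⟩⟩
    · simp only
      omega
    · simp only
      omega
  · rintro ⟨κ, k, ρ⟩ hq
    obtain ⟨h1, h2⟩ := mem_sigma.1 hq
    obtain ⟨h3, h2⟩ := mem_sigma.1 h2
    obtain ⟨h2, hc⟩ := mem_above.1 h2
    have h1 := mem_below.1 h1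
    have h3 := mem_range.1 h3
    obtain ⟨hr, h4, h5⟩ := upperCorner_spec h1 h2 k
    have := hr.card_add
    simp only at *
    refine mem_sigma.2 ⟨mem_above.2 ⟨h4, ?_⟩, mem_below.2 h5⟩
    simp only
    omega
  · rintro ⟨μ, ρ⟩ hp
    obtain ⟨h1, h2⟩ := mem_sigma.1 hp
    obtain ⟨h1, hc⟩ := mem_above.1 h1
    have h2 := mem_below.1 h2
    obtain ⟨hr, h3, h4⟩ := lowerCorner_spec h1 h2
    have := (upperCorner_spec h3 h4 (μ.rowLen 0 - max (ν.rowLen 0) (ρ.rowLen 0))).1.upper_unique hr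
    simp only [this]
  · rintro ⟨κ, k, ρ⟩ hq
    obtain ⟨h1, h2⟩ := mem_sigma.1 hq
    obtain ⟨h3, h2⟩ := mem_sigma.1 h2
    obtain ⟨h2, hc⟩ := mem_above.1 h2
    have h1 := mem_below.1 h1
    obtain ⟨hr, h4, h5⟩ := upperCorner_spec h1 h2 k
    have e := (lowerCorner_spec h4 h5).1.lower_unique hr
    have e' : (upperCorner ν ρ κ k).rowLen 0 - max (ν.rowLen 0) (ρ.rowLen 0) = k := by
      have h0 : (upperCorner ν ρ κ k).rowLen 0 = max (ν.rowLen 0) (ρ.rowLen 0) + k := hr.1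
      omega
    simp only [e, e']
  · rintro ⟨μ, ρ⟩ hp
    obtain ⟨h1, h2⟩ := mem_sigma.1 hp
    obtain ⟨h1, hc⟩ := mem_above.1 h1
    have h2 := mem_below.1 h2
    obtain ⟨hr, h3, h4⟩ := lowerCorner_spec h1 h2
    have := hr.card_add
    have := h3.card_le
    have := h2.card_le
    simp only at *
    congr 1
    have := hr.1
    omega

/-- The Pieri rule. -/
lemma sum_above_schurPoly (N : ℕ) (ν : YoungDiagram) (b : ℕ) :
    ∑ μ ∈ above ν b, schurPoly N μ = schurPoly N ν * hPoly N b := by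
  induction N generalizing ν b with
  | zero =>
    rcases Nat.eq_zero_or_pos b with rfl | hb
    · simp [above_zero, hPoly]
    · rw [hPoly, if_neg hb.ne', mul_zero]
      refine sum_eq_zero fun μ hμ => schurPoly_zero ?_
      have := (mem_above.1 hμ).2
      omega
  | succ N ih =>
    simp_rw [schurPoly_succ]
    rw [sum_above_below ν b fun ρ m => schurPoly N ρ * MvPolynomial.X N ^ m, sum_mul]
    refine sum_congr rfl fun κ _ => ?_
    rw [hPoly, mul_sum]
    refine sum_congr rfl fun k _ => ?_
    rw [← sum_mul, ih, pow_add]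
    ring

/-! ### Words with prescribed descents -/

open Classical in
/-- The words of length `n` in the letters `0, …, N - 1` whose descents, except possibly for the
one at `s`, are the elements of `S`. -/
noncomputable def words (N n s : ℕ) (S : Finset ℕ) : Finset (Fin n → ℕ) :=
  {w ∈ Fintype.piFinset fun _ => range N | ∀ i (h : i + 1 < n), i + 1 ≠ s →
    (w ⟨i + 1, h⟩ < w ⟨i, by omega⟩ ↔ i + 1 ∈ S)}

lemma mem_words {N n s : ℕ} {S : Finset ℕ} {w : Fin n → ℕ} :
    w ∈ words N n s S ↔ (∀ i, w i < N) ∧ ∀ i (h : i + 1 < n), i + 1 ≠ s →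
      (w ⟨i + 1, h⟩ < w ⟨i, by omega⟩ ↔ i + 1 ∈ S) := by
  simp [words]

/-- The generating polynomial of `words N n s S`. -/
noncomputable def wordPoly (N n s : ℕ) (S : Finset ℕ) : MvPolynomial ℕ ℤ :=
  ∑ w ∈ words N n s S, ∏ i, MvPolynomial.X (w i)

lemma wordPoly_add (N s b : ℕ) {S : Finset ℕ} (hS : ∀ i ∈ S, i < s) :
    wordPoly N (s + b) s S = wordPoly N s s S * wordPoly N b 0 ∅ := by
  unfold wordPoly
  rw [sum_mul_sum, ← sum_product']
  refine sum_equiv (Fin.appendEquiv s b).symm (fun w => ?_) (fun w _ => ?_)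
  · rw [mem_product, mem_words, mem_words, mem_words]
    change _ ↔ ((∀ i, w (Fin.castAdd b i) < N) ∧ ∀ i (h : i + 1 < s), i + 1 ≠ s →
      (w ⟨i + 1, by omega⟩ < w ⟨i, by omega⟩ ↔ i + 1 ∈ S)) ∧
      ((∀ i, w (Fin.natAdd s i) < N) ∧ ∀ i (h : i + 1 < b), i + 1 ≠ 0 →
        (w ⟨s + (i + 1), by omega⟩ < w ⟨s + i, by omega⟩ ↔ i + 1 ∈ (∅ : Finset ℕ)))
    constructor
    · rintro ⟨h1, h2⟩
      refine ⟨⟨fun i => h1 _, fun i h h' => h2 i (by omega) h'⟩, fun i => h1 _, fun i h _ => ?_⟩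
      refine (h2 (s + i) (by omega) (by omega)).trans ?_
      simp only [notMem_empty, iff_false]
      intro hm
      have := hS _ hm
      omega
    · rintro ⟨⟨h1, h2⟩, h3, h4⟩
      refine ⟨fun i => Fin.addCases h1 h3 i, fun i h h' => ?_⟩
      rcases lt_or_ge (i + 1) s with hi | hi
      · exact h2 i hi h'
      · obtain ⟨j, rfl⟩ := Nat.exists_eq_add_of_le (show s ≤ i by omega)
        refine (h4 j (by omega) (by omega)).trans ?_
        simp only [notMem_empty, false_iff]
        intro hm
        have := hS _ hm
        omega
  · rw [Fin.prod_univ_add]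
    rfl

lemma hPoly_succ_succ (N b : ℕ) :
    hPoly (N + 1) (b + 1) = hPoly N (b + 1) + hPoly (N + 1) b * MvPolynomial.X N := by
  rw [hPoly, sum_range_succ', hPoly, sum_mul, add_comm]
  congr 1
  · simp
  · refine sum_congr rfl fun k _ => ?_
    rw [pow_succ, Nat.add_sub_add_right]
    ring

lemma hPoly_zero_right (N : ℕ) : hPoly N 0 = 1 := by
  induction N with
  | zero => simp [hPoly]
  | succ N ih => simp [hPoly, ih]

lemma words_empty_mono {N b : ℕ} {w : Fin b → ℕ} :
    w ∈ words N b 0 ∅ ↔ (∀ i, w i < N) ∧ Monotone w := by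
  rw [mem_words]
  refine and_congr_right fun _ => ?_
  cases b with
  | zero => exact ⟨fun _ i => i.elim0, fun _ i h => absurd h (by omega)⟩
  | succ b =>
    rw [Fin.monotone_iff_le_succ]
    constructor
    · intro h i
      have := h i (by omega) (by omega)
      simp only [notMem_empty, iff_false, not_lt] at this
      exact this
    · intro h i hi _
      simp only [notMem_empty, iff_false, not_lt]
      exact h ⟨i, by omega⟩

lemma wordPoly_empty (N b : ℕ) : wordPoly N b 0 ∅ = hPoly N b := by
  induction b generalizing N with
  | zero =>
    rw [hPoly_zero_right, wordPoly]
    have : words N 0 0 ∅ = univ := by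
      ext w
      rw [words_empty_mono]
      exact ⟨fun _ => mem_univ _, fun _ => ⟨fun i => i.elim0, fun i => i.elim0⟩⟩
    rw [this]
    simp
  | succ b ih =>
    induction N with
    | zero =>
      rw [wordPoly, hPoly, if_neg (by omega)]
      refine sum_eq_zero fun w hw => ?_
      exact absurd ((mem_words.1 hw).1 0) (by omega)
    | succ N ih' =>
      rw [hPoly_succ_succ, ← ih', ← ih, wordPoly,
        ← sum_filter_not_add_sum_filter _ (fun w => w (Fin.last b) = N), wordPoly, wordPoly,
        sum_mul]
      congr 1
      · refine sum_congr ?_ fun _ _ => rfl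
        ext w
        rw [mem_filter, words_empty_mono, words_empty_mono]
        constructor
        · rintro ⟨⟨h1, h2⟩, h3⟩
          refine ⟨fun i => ?_, h2⟩
          have := h2 (Fin.le_last i)
          have := h1 (Fin.last b)
          omega
        · rintro ⟨h1, h2⟩
          exact ⟨⟨fun i => (h1 i).trans (Nat.lt_succ_self N), h2⟩, (h1 _).ne⟩
      · refine sum_bij' (fun w _ => Fin.init w) (fun w _ => Fin.snoc (α := fun _ => ℕ) w N)
          ?_ ?_ ?_ ?_ ?_
        · intro w hw
          obtain ⟨hw, h3⟩ := mem_filter.1 hw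
          obtain ⟨h1, h2⟩ := words_empty_mono.1 hw
          exact words_empty_mono.2 ⟨fun i => h1 _, fun i j h => h2 (by simpa using h)⟩
        · intro w hw
          obtain ⟨h1, h2⟩ := words_empty_mono.1 hw
          refine mem_filter.2 ⟨words_empty_mono.2 ⟨fun i => ?_, fun i j h => ?_⟩, by simp⟩
          · refine Fin.lastCases ?_ (fun i => ?_) i
            · simp
            · simpa using h1 i
          · induction j using Fin.lastCases with
            | last =>
              induction i using Fin.lastCases with
              | last => exact le_rfl
              | cast i => simpa using Nat.lt_succ_iff.1 (h1 i)
            | cast j =>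
              induction i using Fin.lastCases with
              | last => exact absurd h (not_le.2 (Fin.castSucc_lt_last j))
              | cast i => simpa using h2 (by simpa using h)
        · intro w hw
          obtain ⟨hw, h3⟩ := mem_filter.1 hw
          rw [← h3]
          exact Fin.snoc_init_self w
        · intro w hw
          exact Fin.init_snoc _ _
        · intro w hw
          obtain ⟨hw, h3⟩ := mem_filter.1 hw
          rw [Fin.prod_univ_castSucc, h3]
          rfl

lemma wordPoly_insert (N : ℕ) {n s : ℕ} {S : Finset ℕ} (h1 : 1 ≤ s) (hn : s < n) (hs : s ∉ S) :
    wordPoly N n s S = wordPoly N n n S + wordPoly N n n (insert s S) := by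
  obtain ⟨t, rfl⟩ := Nat.exists_eq_add_of_le' h1
  rw [wordPoly, ← sum_filter_not_add_sum_filter _ (fun w => w ⟨t + 1, hn⟩ < w ⟨t, by omega⟩)]
  unfold wordPoly
  congr 1 <;> refine sum_congr ?_ fun _ _ => rfl
  · ext w
    rw [mem_filter, mem_words, mem_words]
    constructor
    · rintro ⟨⟨h2, h3⟩, h4⟩
      refine ⟨h2, fun i h _ => ?_⟩
      by_cases hi : i = t
      · subst hi
        exact iff_of_false h4 hs
      · exact h3 i h (by omega)
    · rintro ⟨h2, h3⟩
      exact ⟨⟨h2, fun i h _ => h3 i h h.ne⟩, fun h => hs ((h3 t hn hn.ne).1 h)⟩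
  · ext w
    rw [mem_filter, mem_words, mem_words]
    constructor
    · rintro ⟨⟨h2, h3⟩, h4⟩
      refine ⟨h2, fun i h _ => ?_⟩
      by_cases hi : i = t
      · subst hi
        exact iff_of_true h4 (mem_insert_self _ _)
      · rw [h3 i h (by omega), mem_insert]
        exact (or_iff_right (by omega)).symm
    · rintro ⟨h2, h3⟩
      refine ⟨⟨h2, fun i h hi => ?_⟩, (h3 t hn hn.ne).2 (mem_insert_self _ _)⟩
      rw [h3 i h h.ne, mem_insert]
      exact or_iff_right hi

lemma ncard_stdDesc_insert (μ : YoungDiagram) {n s : ℕ} {S : Finset ℕ} (h1 : 1 ≤ s) (hn : s < n)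
    (hs : s ∉ S) : (stdDesc μ n s S).ncard =
      (stdDesc μ n n S).ncard + (stdDesc μ n n (insert s S)).ncard := by
  rw [← Set.ncard_union_eq _ (finite_stdDesc _ _ _ _) (finite_stdDesc _ _ _ _)]
  · congr 1
    ext f
    simp only [stdDesc, Set.mem_union, Set.mem_ofPred_eq, mem_insert]
    constructor
    · rintro ⟨h2, h3⟩
      by_cases hd : IsDesc μ f s
      · refine Or.inr ⟨h2, fun i hi hi' _ => ?_⟩
        by_cases his : i = s
        · subst his
          exact iff_of_true hd (Or.inl rfl)
        · rw [h3 i hi hi' his, or_iff_right his]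
      · refine Or.inl ⟨h2, fun i hi hi' _ => ?_⟩
        by_cases his : i = s
        · subst his
          exact iff_of_false hd hs
        · rw [h3 i hi hi' his]
    · rintro (⟨h2, h3⟩ | ⟨h2, h3⟩)
      · exact ⟨h2, fun i hi hi' _ => h3 i hi hi' hi'.ne⟩
      · exact ⟨h2, fun i hi hi' his => (h3 i hi hi' hi'.ne).trans (or_iff_right his)⟩
  · rw [Set.disjoint_left]
    rintro f ⟨-, h2⟩ ⟨-, h3⟩
    exact hs ((h2 s h1 hn hn.ne).1 ((h3 s h1 hn hn.ne).2 (mem_insert_self _ _)))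

/-- The Schur expansion counting standard fillings with prescribed descents. -/
noncomputable def stdPoly (N n s : ℕ) (S : Finset ℕ) : MvPolynomial ℕ ℤ :=
  ∑ μ ∈ (finite_card_eq n).toFinset, (stdDesc μ n s S).ncard • schurPoly N μ

lemma stdPoly_eq_mul (N : ℕ) {n s : ℕ} {S : Finset ℕ} (hsn : s ≤ n) (hS : ∀ i ∈ S, i < s) :
    stdPoly N n s S = stdPoly N s s S * hPoly N (n - s) := by
  have e1 : stdPoly N n s S = ∑ μ ∈ (finite_card_eq n).toFinset,
      ∑ ν ∈ below μ with ν.card = s, (stdDesc ν s s S).ncard • schurPoly N μ := by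
    refine sum_congr rfl fun μ hμ => ?_
    rw [ncard_stdDesc (by simpa using hμ) hsn hS, sum_smul]
  rw [e1, stdPoly, sum_mul]
  simp_rw [smul_mul_assoc, ← sum_above_schurPoly, smul_sum]
  refine sum_comm' fun μ ν => ?_
  simp only [Set.Finite.mem_toFinset, Set.mem_ofPred_eq, mem_filter, mem_below, mem_above]
  constructor
  · rintro ⟨h1, h2, h3⟩
    exact ⟨⟨h2, by omega⟩, h3⟩
  · rintro ⟨⟨h1, h2⟩, h3⟩
    exact ⟨by omega, h1, h3⟩

lemma stdPoly_zero (N : ℕ) : stdPoly N 0 0 ∅ = 1 := by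
  have e : (finite_card_eq 0).toFinset = {⊥} := by
    ext μ
    rw [Set.Finite.mem_toFinset, mem_singleton, Set.mem_ofPred_eq]
    constructor
    · intro h
      exact cells_injective (card_eq_zero.1 h)
    · rintro rfl
      exact card_bot
  have e' : stdDesc ⊥ 0 0 ∅ = {fun _ _ => 0} := by
    ext f
    rw [Set.mem_singleton_iff]
    constructor
    · intro h
      funext i j
      exact h.1.1.1 i j (YoungDiagram.notMem_bot _)
    · rintro rfl
      simp [stdDesc, IsStd, IsSemistd, YoungDiagram.notMem_bot]
  rw [stdPoly, e, sum_singleton, schurPoly_bot, e', Set.ncard_singleton, one_smul]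

/-- The generating polynomial of the words with descent set `S` is the sum of the Schur
polynomials, weighted by the number of standard fillings with descent set `S`. -/
lemma wordPoly_eq_stdPoly (N : ℕ) (S : Finset ℕ) (n : ℕ) (hS : ∀ i ∈ S, 1 ≤ i ∧ i < n) :
    wordPoly N n n S = stdPoly N n n S := by
  induction S using Finset.induction_on_max generalizing n with
  | empty =>
    have e1 : wordPoly N n n ∅ = wordPoly N n 0 ∅ := by
      refine sum_congr ?_ fun _ _ => rfl
      ext w
      rw [mem_words, mem_words]
      exact and_congr_right fun _ => ⟨fun h i hi _ => h i hi hi.ne, fun h i hi _ => h i hi (by omega)⟩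
    have e2 : stdPoly N n n ∅ = stdPoly N n 0 ∅ := by
      refine sum_congr rfl fun μ _ => ?_
      congr 2
      ext f
      exact and_congr_right fun _ => ⟨fun h i hi hi' _ => h i hi hi' hi'.ne,
        fun h i hi hi' _ => h i hi hi' (by omega)⟩
    rw [e1, e2, stdPoly_eq_mul N (Nat.zero_le n) (by simp), stdPoly_zero, one_mul, wordPoly_empty,
      Nat.sub_zero]
  | insert s S hs ih =>
    have hsn := hS s (mem_insert_self _ _)
    have h1 : ∀ i ∈ S, 1 ≤ i ∧ i < n := fun i hi => hS i (mem_insert_of_mem hi)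
    have hns : s ∉ S := fun h => lt_irrefl _ (hs s h)
    have e1 := wordPoly_insert N hsn.1 hsn.2 hns
    have e2 : stdPoly N n s S = stdPoly N n n S + stdPoly N n n (insert s S) := by
      rw [stdPoly, stdPoly, stdPoly, ← sum_add_distrib]
      refine sum_congr rfl fun μ _ => ?_
      rw [ncard_stdDesc_insert μ hsn.1 hsn.2 hns, add_smul]
    have e3 : wordPoly N n s S = stdPoly N n s S := by
      obtain ⟨b, rfl⟩ := Nat.exists_eq_add_of_le hsn.2.le
      rw [wordPoly_add N s b hs, stdPoly_eq_mul N hsn.2.le hs, wordPoly_empty,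
        ih s fun i hi => ⟨(h1 i hi).1, hs i hi⟩, Nat.add_sub_cancel_left]
    rw [e1, e2, ih n h1] at e3
    exact add_left_cancel e3

/-! ### Coefficients -/

lemma coeff_sum_prod_X {A ι : Type*} (F : Finset A) (s : Finset ι) (g : A → ι → ℕ) (d : ℕ →₀ ℕ) :
    MvPolynomial.coeff d (∑ a ∈ F, ∏ i ∈ s, (MvPolynomial.X (g a i) : MvPolynomial ℕ ℤ)) =
      #{a ∈ F | ∑ i ∈ s, Finsupp.single (g a i) 1 = d} := by
  have h : ∀ a, ∏ i ∈ s, (MvPolynomial.X (g a i) : MvPolynomial ℕ ℤ) =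
      MvPolynomial.monomial (∑ i ∈ s, Finsupp.single (g a i) 1) 1 := fun a => by
    rw [MvPolynomial.monomial_sum_one]
    rfl
  simp_rw [h, MvPolynomial.coeff_sum, MvPolynomial.coeff_monomial]
  rw [sum_boole]

lemma lt_of_sum_single {ι : Type*} {s : Finset ι} {g : ι → ℕ} {d : ℕ →₀ ℕ} {N : ℕ}
    (h : ∑ i ∈ s, Finsupp.single (g i) 1 = d) (hd : d.support ⊆ range N) {i : ι} (hi : i ∈ s) :
    g i < N := by
  refine mem_range.1 (hd ?_)
  rw [Finsupp.mem_support_iff, ← h, Finsupp.finsetSum_apply]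
  intro h0
  have := (sum_eq_zero_iff.1 h0) i hi
  simp at this

lemma skewSchur_eq_coeff (μ : YoungDiagram) {d : ℕ →₀ ℕ} {N : ℕ} (hd : d.support ⊆ range N) :
    skewSchur (ydCells μ) d = MvPolynomial.coeff d (schurPoly N μ) := by
  rw [skewSchur_ydCells, schurPoly, coeff_sum_prod_X, ← Set.ncard_coe_finset]
  congr 2
  ext f
  simp only [coe_filter, Set.Finite.mem_toFinset, Set.mem_ofPred_eq]
  constructor
  · rintro ⟨h1, h2⟩
    exact ⟨⟨h1, fun i j hm => lt_of_sum_single h2 hd (i := (i, j)) hm⟩, h2⟩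
  · rintro ⟨⟨h1, -⟩, h2⟩
    exact ⟨h1, h2⟩

/-! ### Lists of positive integers and their partial sums -/

/-- The proper nonempty partial sums of a list. -/
def breaks (l : List ℕ) : Finset ℕ := (range (l.length - 1)).image fun k => (l.take (k + 1)).sum

lemma mem_breaks {l : List ℕ} {i : ℕ} :
    i ∈ breaks l ↔ ∃ k, k + 1 < l.length ∧ (l.take (k + 1)).sum = i := by
  simp only [breaks, mem_image, mem_range]
  exact exists_congr fun k => and_congr_left fun _ => by omega

@[simp] lemma breaks_singleton (a : ℕ) : breaks [a] = ∅ := rfl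

lemma mem_breaks_cons_cons {a b i : ℕ} {l : List ℕ} :
    i ∈ breaks (a :: b :: l) ↔ i = a ∨ ∃ j ∈ breaks (b :: l), i = a + j := by
  simp only [mem_breaks]
  constructor
  · rintro ⟨k, hk, rfl⟩
    rcases k with _ | k
    · simp
    · exact Or.inr ⟨_, ⟨k, by simpa using hk, rfl⟩, by simp⟩
  · rintro (rfl | ⟨_, ⟨k, hk, rfl⟩, rfl⟩)
    · exact ⟨0, by simp, by simp⟩
    · exact ⟨k + 1, by simpa using hk, by simp⟩

lemma mem_breaks_succ_cons {a i : ℕ} {l : List ℕ} :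
    i ∈ breaks ((a + 1) :: l) ↔ ∃ j ∈ breaks (a :: l), i = j + 1 := by
  simp only [mem_breaks]
  constructor
  · rintro ⟨k, hk, rfl⟩
    exact ⟨_, ⟨k, by simpa using hk, rfl⟩, by simp; ring⟩
  · rintro ⟨_, ⟨k, hk, rfl⟩, rfl⟩
    exact ⟨k, by simpa using hk, by simp; ring⟩

lemma le_of_mem_breaks {a i : ℕ} {l : List ℕ} (h : i ∈ breaks (a :: l)) : a ≤ i := by
  obtain ⟨k, -, rfl⟩ := mem_breaks.1 h
  simp

lemma breaks_bounds {l : List ℕ} (hl : ∀ a ∈ l, 0 < a) {i : ℕ} (h : i ∈ breaks l) :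
    1 ≤ i ∧ i < l.sum := by
  induction l generalizing i with
  | nil => simp [breaks] at h
  | cons a l ih =>
    have ha := hl a (by simp)
    refine ⟨ha.trans_le (le_of_mem_breaks h), ?_⟩
    rcases l with _ | ⟨b, l⟩
    · simp at h
    · have hb := hl b (by simp)
      simp only [List.sum_cons] at ih ⊢
      rcases mem_breaks_cons_cons.1 h with rfl | ⟨j, hj, rfl⟩
      · omega
      · have := (ih (fun x hx => hl x (List.mem_cons_of_mem _ hx)) hj).2
        omega

lemma breaks_cons_cons_ne_empty (a b : ℕ) (l : List ℕ) : breaks (a :: b :: l) ≠ ∅ :=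
  ne_empty_of_mem (mem_breaks_cons_cons.2 (Or.inl rfl))

/-- A list of positive integers is determined by its sum and its partial sums. -/
lemma eq_of_breaks_eq {l l' : List ℕ} (hl : ∀ a ∈ l, 0 < a) (hl' : ∀ a ∈ l', 0 < a)
    (hs : l.sum = l'.sum) (hb : breaks l = breaks l') : l = l' := by
  induction l generalizing l' with
  | nil =>
    rcases l' with _ | ⟨a, l'⟩
    · rfl
    · have := hl' a (by simp)
      simp only [List.sum_nil, List.sum_cons] at hs
      omega
  | cons a l ih =>
    rcases l' with _ | ⟨a', l'⟩
    · have := hl a (by simp)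
      simp only [List.sum_nil, List.sum_cons] at hs
      omega
    rcases l with _ | ⟨b, l⟩
    · rcases l' with _ | ⟨b', l'⟩
      · simpa using hs
      · exact absurd hb.symm (breaks_cons_cons_ne_empty _ _ _)
    rcases l' with _ | ⟨b', l'⟩
    · exact absurd hb (breaks_cons_cons_ne_empty _ _ _)
    have h1 : a' ≤ a := le_of_mem_breaks (l := b' :: l') (hb ▸ mem_breaks_cons_cons.2 (Or.inl rfl))
    have h2 : a ≤ a' := le_of_mem_breaks (l := b :: l) (hb.symm ▸ mem_breaks_cons_cons.2 (Or.inl rfl))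
    obtain rfl := le_antisymm h1 h2
    have hp : ∀ x ∈ b :: l, 0 < x := fun x hx => hl x (List.mem_cons_of_mem _ hx)
    have hp' : ∀ x ∈ b' :: l', 0 < x := fun x hx => hl' x (List.mem_cons_of_mem _ hx)
    congr 1
    refine ih hp hp' (by simpa using hs) ?_
    have key : ∀ {c : ℕ} {m : List ℕ} (_ : ∀ x ∈ c :: m, 0 < x) (j : ℕ),
        j ∈ breaks (c :: m) ↔ 0 < j ∧ a' + j ∈ breaks (a' :: c :: m) := by
      intro c m hm j
      rw [mem_breaks_cons_cons]
      constructor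
      · intro h
        exact ⟨(breaks_bounds hm h).1, Or.inr ⟨j, h, rfl⟩⟩
      · rintro ⟨h, h' | ⟨j', h', e⟩⟩
        · omega
        · rwa [add_left_cancel e]
    ext j
    rw [key hp, key hp', hb]

/-! ### Descent compositions of words -/

lemma dco_cons_cons_of_lt {a b : ℕ} (r : List ℕ) (h : a < b) {m : ℕ} {t : List ℕ}
    (e : dco (b :: r) = m :: t) : dco (a :: b :: r) = (m + 1) :: t := by
  change (match dco (b :: r), b :: r with
    | m :: t, b :: _ => if a < b then (m + 1) :: t else 1 :: m :: t
    | _, _ => [1]) = _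
  rw [e]
  exact if_pos h

lemma dco_cons_cons_of_not_lt {a b : ℕ} (r : List ℕ) (h : ¬ a < b) {m : ℕ} {t : List ℕ}
    (e : dco (b :: r) = m :: t) : dco (a :: b :: r) = 1 :: m :: t := by
  change (match dco (b :: r), b :: r with
    | m :: t, b :: _ => if a < b then (m + 1) :: t else 1 :: m :: t
    | _, _ => [1]) = _
  rw [e]
  exact if_neg h

lemma dco_cons_ne_nil (a : ℕ) (r : List ℕ) : dco (a :: r) ≠ [] := by
  induction r generalizing a with
  | nil => simp [dco]
  | cons b r ih =>
    obtain ⟨m, t, e⟩ := List.exists_cons_of_ne_nil (ih b)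
    by_cases h : a < b
    · simp [dco_cons_cons_of_lt r h e]
    · simp [dco_cons_cons_of_not_lt r h e]

lemma dco_spec (w : List ℕ) : (∀ a ∈ dco w, 0 < a) ∧ (dco w).sum = w.length ∧
    ∀ i (h : i + 1 < w.length), i + 1 ∈ breaks (dco w) ↔ w[i + 1] ≤ w[i] := by
  induction w with
  | nil => simp [dco]
  | cons a r ih =>
    rcases r with _ | ⟨b, r⟩
    · simp [dco]
    obtain ⟨m, t, e⟩ := List.exists_cons_of_ne_nil (dco_cons_ne_nil b r)
    rw [e] at ih
    obtain ⟨h1, h2, h3⟩ := ih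
    by_cases h : a < b
    · rw [dco_cons_cons_of_lt r h e]
      refine ⟨?_, ?_, fun i hi => ?_⟩
      · simp only [List.mem_cons, forall_eq_or_imp] at h1 ⊢
        exact ⟨Nat.succ_pos _, h1.2⟩
      · simp only [List.sum_cons, List.length_cons] at h2 ⊢
        omega
      · rw [mem_breaks_succ_cons]
        rcases i with _ | i
        · refine iff_of_false ?_ (by simpa using h)
          rintro ⟨j, hj, h0⟩
          have := (breaks_bounds h1 hj).1
          omega
        · refine Iff.trans ?_ (h3 i (by simpa using hi))
          constructor
          · rintro ⟨j, hj, h0⟩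
            rwa [add_right_cancel h0]
          · intro hj
            exact ⟨_, hj, rfl⟩
    · rw [dco_cons_cons_of_not_lt r h e]
      refine ⟨?_, ?_, fun i hi => ?_⟩
      · rw [List.forall_mem_cons]
        exact ⟨one_pos, h1⟩
      · simp only [List.sum_cons, List.length_cons] at h2 ⊢
        omega
      · rw [mem_breaks_cons_cons]
        rcases i with _ | i
        · exact iff_of_true (Or.inl rfl) (by simpa using h)
        · refine Iff.trans ?_ (h3 i (by simpa using hi))
          constructor
          · rintro (h0 | ⟨j, hj, h0⟩)
            · omega
            · rwa [show i + 1 = j by omega]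
          · intro hj
            exact Or.inr ⟨_, hj, by omega⟩

lemma succ_mem_breaks_dco_word {n : ℕ} (π : Equiv.Perm (Fin n)) {i : ℕ} (h : i + 1 < n) :
    i + 1 ∈ breaks (dco (word π)) ↔ π ⟨i + 1, h⟩ < π ⟨i, by omega⟩ := by
  rw [(dco_spec (word π)).2.2 i (by simpa [word] using h)]
  simp only [word, List.getElem_map, List.getElem_finRange, Fin.cast_mk, ← Fin.le_def]
  refine ⟨fun h' => lt_of_le_of_ne h' fun e => ?_, le_of_lt⟩
  simpa using π.injective e

lemma eq_iff_breaks {l l' : List ℕ} {n : ℕ} (hl : ∀ a ∈ l, 0 < a) (hl' : ∀ a ∈ l', 0 < a)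
    (hs : l.sum = n) (hs' : l'.sum = n) :
    l = l' ↔ ∀ i, 1 ≤ i → i < n → (i ∈ breaks l ↔ i ∈ breaks l') := by
  refine ⟨fun h => by simp [h], fun h => eq_of_breaks_eq hl hl' (hs.trans hs'.symm) ?_⟩
  ext i
  constructor
  · intro hi
    obtain ⟨h1, h2⟩ := breaks_bounds hl hi
    exact (h i h1 (hs ▸ h2)).1 hi
  · intro hi
    obtain ⟨h1, h2⟩ := breaks_bounds hl' hi
    exact (h i h1 (hs' ▸ h2)).2 hi

lemma dco_word_eq_iff {n : ℕ} (π : Equiv.Perm (Fin n)) {l : List ℕ} (hl : ∀ a ∈ l, 0 < a)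
    (hs : l.sum = n) : dco (word π) = l ↔
      ∀ i (h : i + 1 < n), π ⟨i + 1, h⟩ < π ⟨i, by omega⟩ ↔ i + 1 ∈ breaks l := by
  obtain ⟨h1, h2, -⟩ := dco_spec (word π)
  rw [eq_iff_breaks h1 hl (h2.trans (by simp [word])) hs]
  constructor
  · intro h i hi
    rw [← succ_mem_breaks_dco_word π hi, h _ (by omega) hi]
  · intro h i hi hn
    obtain ⟨j, rfl⟩ := Nat.exists_eq_add_of_le' hi
    rw [succ_mem_breaks_dco_word π hn, h j hn]

lemma fq_apply (n : ℕ) (l : List ℕ) (d : ℕ →₀ ℕ) : Fq n l d =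
    ({f : Fin n → ℕ | Monotone f ∧
      (∀ i (h : i + 1 < n), i + 1 ∈ breaks l → f ⟨i, by omega⟩ < f ⟨i + 1, h⟩) ∧
      ∑ t, Finsupp.single (f t) 1 = d}.ncard : ℤ) := by
  unfold Fq
  congr 2
  ext f
  refine and_congr_right fun _ => and_congr_left fun _ => ?_
  constructor
  · intro h i hi hm
    obtain ⟨k, hk, e⟩ := mem_breaks.1 hm
    have := h k hk (by omega) (by omega)
    simp only [e] at this
    exact this
  · intro h k hk h1 h2
    obtain ⟨j, hj⟩ := Nat.exists_eq_add_of_le' h1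
    have := h j (by omega) (hj ▸ mem_breaks.2 ⟨k, hk, rfl⟩)
    simp only [hj]
    exact this

/-! ### Standardization -/

section Standardization

variable {n : ℕ} {π : Equiv.Perm (Fin n)} {f : Fin n → ℕ}

lemma lt_of_tie (hf : Monotone f)
    (hs : ∀ i (h : i + 1 < n), π ⟨i + 1, h⟩ < π ⟨i, by omega⟩ → f ⟨i, by omega⟩ < f ⟨i + 1, h⟩)
    {i j : Fin n} (hij : i < j) (he : f i = f j) : π i < π j := by
  obtain ⟨i, hi⟩ := i
  obtain ⟨j, hj⟩ := j
  obtain ⟨k, rfl⟩ := Nat.exists_eq_add_of_lt (show i < j from hij)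
  clear hij
  have key : ∀ m (_ : m ≤ k), π ⟨i, hi⟩ < π ⟨i + m + 1, by omega⟩ := by
    have step : ∀ m (hm : m ≤ k), π ⟨i + m, by omega⟩ < π ⟨i + m + 1, by omega⟩ := by
      intro m hm
      rcases lt_trichotomy (π ⟨i + m, by omega⟩) (π ⟨i + m + 1, by omega⟩) with h | h | h
      · exact h
      · simpa using π.injective h
      · have h0 := hs (i + m) (by omega) h
        have h1 : f ⟨i, hi⟩ ≤ f ⟨i + m, by omega⟩ := hf (by simp [Fin.le_def])
        have h2 : f ⟨i + m + 1, by omega⟩ ≤ f ⟨i + k + 1, hj⟩ :=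
          hf (by simp only [Fin.le_def]; omega)
        omega
    intro m hm
    induction m with
    | zero => exact step 0 hm
    | succ m ih => exact (ih (by omega)).trans (step (m + 1) hm)
  exact key k le_rfl

lemma comp_symm_lt_iff (hf : Monotone f) (ht : ∀ i j, i < j → f i = f j → π i < π j)
    {a b : Fin n} (hab : a < b) : f (π.symm b) < f (π.symm a) ↔ π.symm b < π.symm a := by
  refine ⟨fun h => lt_of_not_ge fun h' => (hf h').not_gt h, fun h => lt_of_le_of_ne (hf h.le) ?_⟩
  intro he
  have := ht _ _ h he
  simp only [Equiv.apply_symm_apply] at this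
  exact this.not_gt hab

lemma eq_sort_comp_symm_iff : π = Tuple.sort (f ∘ π.symm) ↔ Monotone f ∧
    ∀ i (h : i + 1 < n), π ⟨i + 1, h⟩ < π ⟨i, by omega⟩ → f ⟨i, by omega⟩ < f ⟨i + 1, h⟩ := by
  have e : (f ∘ π.symm) ∘ π = f := by funext i; simp
  rw [Tuple.eq_sort_iff, e]
  simp only [Function.comp_apply, Equiv.symm_apply_apply]
  refine and_congr_right fun hf => ⟨fun h i hi hd => ?_, fun h i j hij he => lt_of_tie hf h hij he⟩
  refine lt_of_le_of_ne (hf (by simp [Fin.le_def])) fun he => ?_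
  exact (h _ _ (by simp [Fin.lt_def]) he).not_gt hd

end Standardization

/-- Words with prescribed descents, sorted by their standardization. -/
lemma sum_fq_apply {n N : ℕ} {l : List ℕ} (hl : ∀ a ∈ l, 0 < a) (hs : l.sum = n) {d : ℕ →₀ ℕ}
    (hd : d.support ⊆ range N) :
    ∑ π : Equiv.Perm (Fin n) with dco (word π⁻¹) = l, Fq n (dco (word π)) d =
      #{w ∈ words N n n (breaks l) | ∑ t, Finsupp.single (w t) 1 = d} := by
  have des : ∀ (f : Fin n → ℕ) (π : Equiv.Perm (Fin n)), π = Tuple.sort (f ∘ π.symm) →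
      ∀ i (h : i + 1 < n), (f ∘ π.symm) ⟨i + 1, h⟩ < (f ∘ π.symm) ⟨i, by omega⟩ ↔
        π⁻¹ ⟨i + 1, h⟩ < π⁻¹ ⟨i, by omega⟩ := by
    intro f π h i hi
    obtain ⟨h1, h2⟩ := eq_sort_comp_symm_iff.1 h
    exact comp_symm_lt_iff h1 (fun a b => lt_of_tie h1 h2) (by simp [Fin.lt_def])
  rw [card_eq_sum_card_fiberwise (f := Tuple.sort) (t := univ.filter fun π : Equiv.Perm (Fin n) =>
    dco (word π⁻¹) = l)]
  · push_cast
    refine sum_congr rfl fun π hπ => ?_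
    have hπ' := (dco_word_eq_iff _ hl hs).1 (mem_filter.1 hπ).2
    rw [fq_apply, ← Set.ncard_coe_finset,
      ← Set.ncard_image_of_injective (SetLike.coe {w ∈ {w ∈ words N n n (breaks l) |
        ∑ t, Finsupp.single (w t) 1 = d} | Tuple.sort w = π})
        (Function.Surjective.injective_comp_right π.surjective)]
    congr 2
    ext f
    have e : f = (f ∘ π.symm) ∘ π := by funext i; simp
    conv_rhs =>
      rw [e, Function.Injective.mem_set_image
        (Function.Surjective.injective_comp_right π.surjective)]
    simp only [Set.mem_ofPred_eq, coe_filter, mem_filter, mem_words]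
    rw [forall₂_congr fun i (h : i + 1 < n) => imp_congr_left (succ_mem_breaks_dco_word π h),
      ← and_assoc, ← eq_sort_comp_symm_iff, and_comm, eq_comm (a := π)]
    refine and_congr_left fun h => ?_
    have hsum : ∑ t, Finsupp.single ((f ∘ π.symm) t) 1 = ∑ t, Finsupp.single (f t) 1 :=
      Equiv.sum_comp π.symm fun t => Finsupp.single (f t) 1
    rw [hsum]
    refine (and_iff_right_of_imp fun h' => ⟨fun i => ?_, fun i hi _ => ?_⟩).symm
    · exact lt_of_sum_single h' hd (mem_univ (π.symm i))
    · rw [des f π h.symm i hi, hπ' i hi]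
  · intro w hw
    obtain ⟨hw, -⟩ := mem_filter.1 hw
    refine mem_filter.2 ⟨mem_univ _, (dco_word_eq_iff _ hl hs).2 fun i hi => ?_⟩
    have e : (w ∘ Tuple.sort w) ∘ (Tuple.sort w).symm = w := by funext i; simp
    have := des (w ∘ Tuple.sort w) (Tuple.sort w) (by rw [e]) i hi
    rw [e] at this
    rw [← this, (mem_words.1 hw).2 i hi hi.ne]

/-! ### Ribbons -/

/-- The number of rows of the ribbon of `l` below the row of its `i`-th cell. -/
def height (l : List ℕ) (i : ℕ) : ℕ := #{b ∈ breaks l | b ≤ i}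

lemma height_succ (l : List ℕ) (i : ℕ) :
    height l (i + 1) = height l i + if i + 1 ∈ breaks l then 1 else 0 := by
  have : {b ∈ breaks l | b ≤ i + 1} = {b ∈ breaks l | b ≤ i} ∪ {b ∈ breaks l | b = i + 1} := by
    ext b
    simp only [mem_filter, mem_union, ← and_or_left]
    exact and_congr_right fun _ => by omega
  rw [height, this, card_union_of_disjoint, filter_eq']
  · congr 1
    split_ifs <;> simp
  · rw [disjoint_left]
    intro b hb hb'
    have := (mem_filter.1 hb).2
    have := (mem_filter.1 hb').2
    omega

lemma height_cons_of_lt {a i : ℕ} {l : List ℕ} (h : i < a) : height (a :: l) i = 0 := by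
  rw [height, card_eq_zero, filter_eq_empty_iff]
  intro b hb
  have := le_of_mem_breaks hb
  omega

lemma height_cons_cons_add {a b : ℕ} {l : List ℕ} (hb : 0 < b) (j : ℕ) :
    height (a :: b :: l) (a + j) = height (b :: l) j + 1 := by
  have : {c ∈ breaks (a :: b :: l) | c ≤ a + j} =
      insert a ({c ∈ breaks (b :: l) | c ≤ j}.image (a + ·)) := by
    ext c
    simp only [mem_filter, mem_insert, mem_image, mem_breaks_cons_cons]
    constructor
    · rintro ⟨rfl | ⟨k, hk, rfl⟩, h⟩
      · exact Or.inl rfl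
      · exact Or.inr ⟨k, ⟨hk, by omega⟩, rfl⟩
    · rintro (rfl | ⟨k, ⟨hk, h⟩, rfl⟩)
      · exact ⟨Or.inl rfl, by omega⟩
      · exact ⟨Or.inr ⟨k, hk, rfl⟩, by omega⟩
  rw [height, this, card_insert_of_notMem, card_image_of_injective _ (add_right_injective a)]
  · rfl
  · rw [mem_image]
    rintro ⟨k, hk, h⟩
    have := le_of_mem_breaks (mem_filter.1 hk).1
    omega

/-- The `i`-th cell of the ribbon of `l`, read from the bottom left. -/
def ribbonCell (l : List ℕ) (i : ℕ) : ℤ × ℤ := (-(height l i : ℤ), (i : ℤ) - height l i)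

lemma ribbonCell_injective (l : List ℕ) : Function.Injective (ribbonCell l) := by
  intro i j h
  simp only [ribbonCell, Prod.mk.injEq] at h
  omega

lemma ribbonAux_eq {l : List ℕ} (hl : ∀ a ∈ l, 0 < a) (p : ℤ × ℤ) :
    ribbonAux l p = (range l.sum).image fun i => p + ribbonCell l i := by
  induction l generalizing p with
  | nil => simp [ribbonAux]
  | cons a l ih =>
    rw [ribbonAux, ih fun x hx => hl x (List.mem_cons_of_mem _ hx), List.sum_cons, range_eq_Ico,
      range_eq_Ico, range_eq_Ico, ← Ico_union_Ico_eq_Ico (Nat.zero_le a) (Nat.le_add_right a l.sum),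
      image_union]
    congr 1
    · refine image_congr fun j hj => ?_
      simp only [coe_Ico, Set.mem_Ico] at hj
      simp [ribbonCell, height_cons_of_lt hj.2, Prod.ext_iff]
    · rcases l with _ | ⟨b, l⟩
      · simp
      · have e : Ico a (a + (b :: l).sum) = (Ico 0 (b :: l).sum).image (a + ·) := by
          rw [image_add_left_Ico, add_zero]
        rw [e, image_image]
        refine image_congr fun j _ => ?_
        simp only [Function.comp_apply, ribbonCell,
          height_cons_cons_add (hl b (by simp)) j, Prod.ext_iff, Prod.fst_add, Prod.snd_add]
        push_cast
        constructor <;> ring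

lemma ribbonOfList_eq {l : List ℕ} (hl : ∀ a ∈ l, 0 < a) {n : ℕ} (hs : l.sum = n) :
    ribbonOfList l = univ.image fun i : Fin n => ribbonCell l i := by
  rw [ribbonOfList, ribbonAux_eq hl, hs]
  ext c
  simp only [mem_image, mem_range, mem_univ, true_and, Fin.exists_iff, exists_prop]
  simp [Prod.ext_iff]

lemma ribbonCell_right {l : List ℕ} {i j : ℕ} :
    ((ribbonCell l i).1, (ribbonCell l i).2 + 1) = ribbonCell l j ↔
      j = i + 1 ∧ i + 1 ∉ breaks l := by
  have := height_succ l i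
  constructor
  · intro h
    simp only [ribbonCell, Prod.mk.injEq] at h
    obtain rfl : j = i + 1 := by omega
    refine ⟨rfl, fun hb => ?_⟩
    rw [if_pos hb] at this
    omega
  · rintro ⟨rfl, hb⟩
    rw [if_neg hb] at this
    simp only [ribbonCell, Prod.mk.injEq, this]
    push_cast
    constructor <;> ring

lemma ribbonCell_below {l : List ℕ} {i j : ℕ} :
    ((ribbonCell l j).1 + 1, (ribbonCell l j).2) = ribbonCell l i ↔
      j = i + 1 ∧ i + 1 ∈ breaks l := by
  have := height_succ l i
  constructor
  · intro h
    simp only [ribbonCell, Prod.mk.injEq] at h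
    obtain rfl : j = i + 1 := by omega
    refine ⟨rfl, by_contra fun hb => ?_⟩
    rw [if_neg hb] at this
    omega
  · rintro ⟨rfl, hb⟩
    rw [if_pos hb] at this
    simp only [ribbonCell, Prod.mk.injEq, this]
    push_cast
    constructor <;> ring

lemma skewSchur_ribbonOfList {l : List ℕ} (hl : ∀ a ∈ l, 0 < a) {n N : ℕ} (hs : l.sum = n)
    {d : ℕ →₀ ℕ} (hd : d.support ⊆ range N) : skewSchur (ribbonOfList l) d =
      #{w ∈ words N n n (breaks l) | ∑ t, Finsupp.single (w t) 1 = d} := by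
  have inj : Function.Injective fun i : Fin n => ribbonCell l i :=
    (ribbonCell_injective l).comp Fin.val_injective
  have hinj : Function.Injective fun w : Fin n → ℕ =>
      Function.extend (fun i : Fin n => ribbonCell l i) w 0 := fun w w' h => by
    funext i
    have := congrFun h (ribbonCell l i)
    simpa only [inj.extend_apply] using this
  rw [ribbonOfList_eq hl hs, skewSchur, ← Set.ncard_coe_finset, ← Set.ncard_image_of_injective
    (SetLike.coe {w ∈ words N n n (breaks l) | ∑ t, Finsupp.single (w t) 1 = d}) hinj]
  congr 2
  have key : ∀ w : Fin n → ℕ,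
      ((∀ i : Fin n, ((ribbonCell l i).1, (ribbonCell l i).2 + 1) ∈
          univ.image (fun i : Fin n => ribbonCell l i) →
        w i ≤ Function.extend (fun i : Fin n => ribbonCell l i) w 0
          ((ribbonCell l i).1, (ribbonCell l i).2 + 1)) ∧
      (∀ i : Fin n, ((ribbonCell l i).1 + 1, (ribbonCell l i).2) ∈
          univ.image (fun i : Fin n => ribbonCell l i) →
        w i < Function.extend (fun i : Fin n => ribbonCell l i) w 0
          ((ribbonCell l i).1 + 1, (ribbonCell l i).2))) ↔
      ∀ i (h : i + 1 < n), (w ⟨i + 1, h⟩ < w ⟨i, by omega⟩ ↔ i + 1 ∈ breaks l) := by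
    intro w
    constructor
    · rintro ⟨h1, h2⟩ i hi
      by_cases hb : i + 1 ∈ breaks l
      · have e := ribbonCell_below.2 ⟨rfl, hb⟩
        have := h2 ⟨i + 1, hi⟩
        rw [e, inj.extend_apply w 0 ⟨i, by omega⟩] at this
        exact iff_of_true (this (mem_image.2 ⟨⟨i, by omega⟩, mem_univ _, rfl⟩)) hb
      · have e := ribbonCell_right.2 ⟨rfl, hb⟩
        have := h1 ⟨i, by omega⟩
        rw [e, inj.extend_apply w 0 ⟨i + 1, hi⟩] at this
        exact iff_of_false (this (mem_image.2 ⟨⟨i + 1, hi⟩, mem_univ _, rfl⟩)).not_gt hb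
    · intro h
      refine ⟨fun i hm => ?_, fun i hm => ?_⟩
      · obtain ⟨⟨j, hj⟩, -, e⟩ := mem_image.1 hm
        rw [← e, inj.extend_apply w 0 ⟨j, hj⟩]
        obtain ⟨rfl, hb⟩ := ribbonCell_right.1 e.symm
        exact not_lt.1 fun h' => hb ((h i hj).1 h')
      · obtain ⟨⟨j, hj⟩, -, e⟩ := mem_image.1 hm
        rw [← e, inj.extend_apply w 0 ⟨j, hj⟩]
        obtain ⟨i, hi⟩ := i
        obtain ⟨rfl, hb⟩ := ribbonCell_below.1 e.symm
        exact (h j hi).2 hb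
  ext T
  simp only [Set.mem_ofPred_eq, Set.mem_image, SetLike.mem_coe, mem_filter, mem_words]
  constructor
  · rintro ⟨h0, h1, h2, h3⟩
    have eT : Function.extend (fun i : Fin n => ribbonCell l i)
        (fun i : Fin n => T (ribbonCell l i)) 0 = T := by
      funext c
      by_cases hc : ∃ i : Fin n, ribbonCell l i = c
      · obtain ⟨i, rfl⟩ := hc
        exact inj.extend_apply _ _ i
      · rw [Function.extend_apply' _ _ _ hc, h0 c (by simpa using hc)]
        rfl
    rw [sum_image inj.injOn] at h3
    refine ⟨fun i => T (ribbonCell l i), ⟨⟨fun i => lt_of_sum_single h3 hd (mem_univ i), ?_⟩, h3⟩, eT⟩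
    have := (key fun i => T (ribbonCell l i)).1 (by
      rw [eT]
      exact ⟨fun i => h1 _ (mem_image_of_mem _ (mem_univ i)),
        fun i => h2 _ (mem_image_of_mem _ (mem_univ i))⟩)
    exact fun i hi _ => this i hi
  · rintro ⟨w, ⟨⟨-, h2⟩, h3⟩, rfl⟩
    obtain ⟨k1, k2⟩ := (key w).2 fun i hi => h2 i hi hi.ne
    refine ⟨fun c hc => ?_, ?_, ?_, ?_⟩
    · exact Function.extend_apply' _ _ _ (by simpa using hc)
    · rw [forall_mem_image]
      intro i _
      rw [inj.extend_apply]
      exact k1 i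
    · rw [forall_mem_image]
      intro i _
      rw [inj.extend_apply]
      exact k2 i
    · rw [sum_image inj.injOn]
      simpa only [inj.extend_apply] using h3

/-! ### Descent compositions of tableaux -/

lemma sum_take_map_sub (L : List ℕ) (hL : L.Pairwise (· < ·)) {k : ℕ} (hk : k < L.length) :
    ((((List.range L.length).map fun k =>
      L.getD k 0 - (if k = 0 then 0 else L.getD (k - 1) 0)).take (k + 1)).sum) = L[k] := by
  rw [← List.map_take, List.take_range, min_eq_left hk]
  induction k with
  | zero => simp [hk]
  | succ k ih =>
    rw [List.range_succ, List.map_append, List.sum_append, ih (by omega)]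
    have : L[k] < L[k + 1] := List.pairwise_iff_getElem.1 hL k (k + 1) (by omega) hk (by omega)
    simp only [List.map_cons, List.map_nil, List.sum_cons, List.sum_nil, Nat.add_sub_cancel,
      List.getD_eq_getElem _ _ hk, List.getD_eq_getElem _ _ (show k < L.length by omega),
      if_neg (Nat.succ_ne_zero k)]
    omega

/-- The successive differences of the sorted elements of a finite set of positive integers with
maximum `n`. -/
lemma differences_spec {F : Finset ℕ} {n : ℕ} (hF : F ⊆ Icc 1 n) (hn : n ∈ F) {l : List ℕ}
    (h : l = (List.range (F.sort (· ≤ ·)).length).map fun k =>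
      (F.sort (· ≤ ·)).getD k 0 - (if k = 0 then 0 else (F.sort (· ≤ ·)).getD (k - 1) 0)) :
    (∀ a ∈ l, 0 < a) ∧ l.sum = n ∧ ∀ i, i ∈ breaks l ↔ i ∈ F ∧ i ≠ n := by
  set L := F.sort (· ≤ ·) with hL
  have hp : L.Pairwise (· < ·) := F.sortedLT_sort.pairwise
  have hm : ∀ x, x ∈ L ↔ x ∈ F := fun x => mem_sort _
  have hlen : l.length = L.length := by simp [h]
  have hlt := List.pairwise_iff_getElem.1 hp
  have htake : ∀ k (hk : k < L.length), (l.take (k + 1)).sum = L[k] := fun k hk => by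
    rw [h]
    exact sum_take_map_sub L hp hk
  have hlast : ∀ k (hk : k < L.length), L[k] = n ↔ k + 1 = L.length := by
    obtain ⟨m, hm', e⟩ := List.mem_iff_getElem.1 ((hm n).2 hn)
    have hmax : ∀ k (hk : k < L.length), L[k] ≤ n := fun k hk =>
      (mem_Icc.1 (hF ((hm _).1 (List.getElem_mem hk)))).2
    have hml : m + 1 = L.length := by
      by_contra hne
      have := hlt m (m + 1) hm' (by omega) (by omega)
      have := hmax (m + 1) (by omega)
      omega
    intro k hk
    constructor
    · intro hkn
      rcases lt_trichotomy k m with h' | h' | h'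
      · have := hlt k m hk hm' h'
        omega
      · omega
      · omega
    · intro hkl
      obtain rfl : k = m := by omega
      exact e
  have hpos : 0 < L.length := List.length_pos_of_mem ((hm n).2 hn)
  refine ⟨?_, ?_, fun i => ?_⟩
  · rw [h]
    simp only [List.mem_map, List.mem_range, forall_exists_index, and_imp,
      forall_apply_eq_imp_iff₂]
    intro k hk
    rw [List.getD_eq_getElem _ _ hk]
    rcases k with _ | k
    · rw [if_pos rfl]
      exact (mem_Icc.1 (hF ((hm _).1 (List.getElem_mem hk)))).1
    · rw [if_neg (Nat.succ_ne_zero k), Nat.add_sub_cancel,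
        List.getD_eq_getElem _ _ (show k < L.length by omega)]
      exact Nat.sub_pos_of_lt (hlt k (k + 1) (by omega) hk (by omega))
  · have := htake (L.length - 1) (by omega)
    rw [List.take_of_length_le (by omega)] at this
    rw [this]
    exact (hlast _ _).2 (by omega)
  · rw [mem_breaks, hlen]
    constructor
    · rintro ⟨k, hk, rfl⟩
      rw [htake k (by omega), Ne, hlast k (by omega), ← hm]
      exact ⟨List.getElem_mem _, hk.ne⟩
    · rintro ⟨h1, h2⟩
      obtain ⟨k, hk, rfl⟩ := List.mem_iff_getElem.1 ((hm i).2 h1)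
      rw [Ne, hlast k hk] at h2
      exact ⟨k, by omega, htake k hk⟩

lemma coSYT_toPlane_eq_iff {μ : YoungDiagram} {n : ℕ} (hn : 0 < n) (f : ℕ → ℕ → ℕ) {l : List ℕ}
    (hl : ∀ a ∈ l, 0 < a) (hs : l.sum = n) : coSYT (ydCells μ) n (toPlane f) = l ↔
      ∀ i, 1 ≤ i → i < n → (IsDesc μ f i ↔ i ∈ breaks l) := by
  have hF : ∀ i, i ∈ desFinsetTab (ydCells μ) n (toPlane f) ↔
      (1 ≤ i ∧ i ≤ n) ∧ (i = n ∨ IsDesc μ f i) := fun i => by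
    rw [desFinsetTab, mem_filter, mem_Icc, isDesc_iff_toPlane]
  obtain ⟨h1, h2, h3⟩ := differences_spec (F := desFinsetTab (ydCells μ) n (toPlane f))
    (fun i hi => mem_Icc.2 ((hF i).1 hi).1) ((hF n).2 ⟨⟨hn, le_rfl⟩, Or.inl rfl⟩)
    (l := coSYT (ydCells μ) n (toPlane f)) rfl
  rw [eq_iff_breaks h1 hl h2 hs]
  refine forall₃_congr fun i hi hin => ?_
  rw [h3, hF]
  have : ((1 ≤ i ∧ i ≤ n) ∧ (i = n ∨ IsDesc μ f i)) ∧ i ≠ n ↔ IsDesc μ f i :=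
    ⟨fun h => h.1.2.resolve_left h.2, fun h => ⟨⟨⟨hi, hin.le⟩, Or.inr h⟩, hin.ne⟩⟩
  rw [this]

lemma ncard_isSYT_coSYT {μ : YoungDiagram} {n : ℕ} (hn : 0 < n) {l : List ℕ}
    (hl : ∀ a ∈ l, 0 < a) (hs : l.sum = n) :
    {T : ℤ × ℤ → ℕ | IsSYT (ydCells μ) n T ∧ coSYT (ydCells μ) n T = l}.ncard =
      (stdDesc μ n n (breaks l)).ncard := by
  rw [← Set.ncard_image_of_injective (stdDesc _ _ _ _) toPlane_injective]
  congr 1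
  have key : ∀ f, IsSYT (ydCells μ) n (toPlane f) ∧ coSYT (ydCells μ) n (toPlane f) = l ↔
      f ∈ stdDesc μ n n (breaks l) := fun f => by
    rw [isSYT_toPlane, coSYT_toPlane_eq_iff hn f hl hs]
    exact and_congr_right fun _ => forall₃_congr fun i _ hi =>
      ⟨fun h _ => h, fun h => h hi.ne⟩
  ext T
  constructor
  · intro hT
    have e := eq_toPlane hT.1.1
    rw [← e] at hT ⊢
    exact ⟨_, (key _).1 hT, rfl⟩
  · rintro ⟨f, hf, rfl⟩
    exact (key f).2 hf

end RibbonSchur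

/-- For every composition `α` of a positive integer `n`, the
ribbon Schur function satisfies
`r_α = Σ_{π ∈ D_α⁻¹} F_{co(π)} = Σ_{λ ⊢ n} c_λ(α) s_λ`,
where `c_λ(α)` is the number of standard Young tableaux of shape `λ` with
descent composition `α`.  In particular the quasisymmetric generating function
of the inverse descent class `D_α⁻¹` is Schur-positive. -/
theorem statement2 (n : ℕ) (hn : 0 < n) (α : Composition n) :
    (skewSchur (ribbonOfList α.blocks) =
        ∑ π ∈ Finset.univ.filter
            (fun π : Equiv.Perm (Fin n) => dco (word π⁻¹) = α.blocks),
          Fq n (dco (word π))) ∧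
      skewSchur (ribbonOfList α.blocks) =
        ∑ᶠ (μ : YoungDiagram) (_ : μ.card = n),
          ({T : ℤ × ℤ → ℕ | IsSYT (ydCells μ) n T ∧
              coSYT (ydCells μ) n T = α.blocks}.ncard) • skewSchur (ydCells μ) := by
  have hl : ∀ a ∈ α.blocks, 0 < a := fun a ha => α.blocks_pos ha
  have hs := α.blocks_sum
  constructor <;> ext d <;>
    obtain ⟨N, hN⟩ : ∃ N, d.support ⊆ Finset.range N := d.support.exists_nat_subset_range
  · rw [map_sum]
    exact (RibbonSchur.skewSchur_ribbonOfList hl hs hN).trans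
      (RibbonSchur.sum_fq_apply hl hs hN).symm
  · refine Eq.trans ?_ (congrArg (MvPowerSeries.coeff d)
      (finsum_mem_eq_finite_toFinset_sum _ (RibbonSchur.finite_card_eq n)).symm)
    rw [map_sum]
    refine (RibbonSchur.skewSchur_ribbonOfList hl hs hN).trans ?_
    rw [← RibbonSchur.coeff_sum_prod_X]
    have := RibbonSchur.wordPoly_eq_stdPoly N (RibbonSchur.breaks α.blocks) n fun i hi =>
      hs ▸ RibbonSchur.breaks_bounds hl hi
    rw [RibbonSchur.wordPoly, RibbonSchur.stdPoly] at this
    rw [this, MvPolynomial.coeff_sum]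
    refine Finset.sum_congr rfl fun μ _ => ?_
    rw [RibbonSchur.ncard_isSYT_coSYT hn hl hs, map_nsmul, MvPolynomial.coeff_smul,
      ← RibbonSchur.skewSchur_eq_coeff μ hN]
    rfl
end
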